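/- arXiv:2302.12553 — 2 statements merged into one kernel-verified Lean document; each statement's English description precedes it below -/
import Mathlib

section
/- Let P, Q ⊂ R^n be polytopes. There exist α ∈ R^n and β ∈ R such that for every c ∈ R^n \ {0}, the faces F_c = argmin{cᵀx : x ∈ P} and G_c = argmin{(c + α)ᵀx : x ∈ Q} satisfy Lin(F_c) ∩ Lin(G_c) = {0}, and moreover, writing F⁰_c = argmin{(cᵀ,1)z : z ∈ P⁰} and G^{α,β}_c = argmin{(cᵀ,1)z : z ∈ Q^{α,β}} where P⁰ = {(p, 0) : p ∈ P} ⊂ R^{n+1} and Q^{α,β} = {(q, αᵀq + β) : q ∈ Q} ⊂ R^{n+1}, the affine hulls of F⁰_c and G^{α,β}_c are disjoint. -/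
open Pointwise MeasureTheory

noncomputable section

/-- Standard dot product on `Fin n → ℝ`. -/
def dotR {n : ℕ} (c x : Fin n → ℝ) : ℝ := ∑ i, c i * x i

/-- The set of minimizers of the linear functional `x ↦ cᵀx` over `P`. -/
def argminSet {n : ℕ} (c : Fin n → ℝ) (P : Set (Fin n → ℝ)) : Set (Fin n → ℝ) :=
  {x ∈ P | ∀ y ∈ P, dotR c x ≤ dotR c y}

/-- A polytope: the convex hull of a nonempty finite set of points. -/
def IsPolytope {n : ℕ} (P : Set (Fin n → ℝ)) : Prop :=
  ∃ V : Finset (Fin n → ℝ), V.Nonempty ∧ P = convexHull ℝ (V : Set (Fin n → ℝ))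

/-- A lattice polytope: the convex hull of a nonempty finite set of integral points. -/
def IsLatticePolytope {n : ℕ} (P : Set (Fin n → ℝ)) : Prop :=
  ∃ V : Finset (Fin n → ℤ), V.Nonempty ∧
    P = convexHull ℝ ((fun v (i : Fin n) => ((v i : ℤ) : ℝ)) '' (V : Set (Fin n → ℤ)))

/-- `F` is a face of `P`: either the empty face or the set of minimizers of a
linear functional over `P`. -/
def IsFace {n : ℕ} (P F : Set (Fin n → ℝ)) : Prop :=
  F = ∅ ∨ ∃ c : Fin n → ℝ, F = argminSet c P

/-- The dimension of a set: the rank of the direction space of its affine span. -/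
def polyDim {n : ℕ} (P : Set (Fin n → ℝ)) : ℕ :=
  Module.finrank ℝ (affineSpan ℝ P).direction

/-- A point all of whose coordinates are integers. -/
def IsIntPt {m : ℕ} (x : Fin m → ℝ) : Prop := ∀ i, ∃ z : ℤ, x i = (z : ℝ)

/-- An affine chart identifying the affine hull of `P` with `ℝ^r` and mapping the induced
lattice of integral points bijectively onto `ℤ^r`. -/
def IsLatticeChart {n r : ℕ} (P : Set (Fin n → ℝ))
    (φ : (Fin n → ℝ) →ᵃ[ℝ] (Fin r → ℝ)) : Prop :=
  Set.BijOn (fun x => φ x) (affineSpan ℝ P : Set (Fin n → ℝ)) Set.univ ∧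
  ∀ x ∈ affineSpan ℝ P, (IsIntPt x ↔ IsIntPt (φ x))

open Classical in
/-- The normalized volume of a (rational) polytope `P`: `r!` times the Euclidean volume of
the image of `P` under a lattice-preserving affine chart of its affine hull (`r = dim P`).
This is well defined (independent of the chart) and integral for lattice polytopes. -/
def normVol {n : ℕ} (P : Set (Fin n → ℝ)) : ℝ :=
  (Nat.factorial (polyDim P)) *
    (if h : ∃ φ : (Fin n → ℝ) →ᵃ[ℝ] (Fin (polyDim P) → ℝ), IsLatticeChart P φ
      then (volume ((fun x => h.choose x) '' P)).toReal
      else 0)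

/-- The normalized volume is an even integer. -/
def EvenVol {n : ℕ} (P : Set (Fin n → ℝ)) : Prop := ∃ m : ℤ, normVol P = 2 * (m : ℝ)

/-- The class `Q_k`: lattice polytopes all of whose faces of dimension at least `2^k`
have even normalized volume. -/
def InQclass (k : ℕ) {n : ℕ} (P : Set (Fin n → ℝ)) : Prop :=
  IsLatticePolytope P ∧ ∀ F, IsFace P F → 2 ^ k ≤ polyDim F → EvenVol F

/-- The classes `P_k` of lattice polytopes dual to `k`-hidden-layer integral ReLU networks:
`P_0` consists of single lattice points, and `P_{k+1}` consists of finite Minkowski sums of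
convex hulls of unions of pairs of polytopes from `P_k`. -/
def InPclass {n : ℕ} : ℕ → Set (Fin n → ℝ) → Prop
  | 0, P => ∃ v : Fin n → ℤ, P = {fun i => ((v i : ℤ) : ℝ)}
  | k+1, P => ∃ (l : ℕ) (Q : Fin l → Set (Fin n → ℝ)), 0 < l ∧
      (∀ i, ∃ Q₁ Q₂ : Set (Fin n → ℝ), InPclass k Q₁ ∧ InPclass k Q₂ ∧
        Q i = convexHull ℝ (Q₁ ∪ Q₂)) ∧
      P = ∑ i, Q i

/-- A (polyhedral) subdivision of `R`: a finite collection of polytopes covering `R`,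
any two of which intersect in a common face. -/
def IsSubdivision {n : ℕ} (R : Set (Fin n → ℝ)) (𝒞 : Finset (Set (Fin n → ℝ))) : Prop :=
  (∀ C ∈ 𝒞, IsPolytope C) ∧
  (⋃ C ∈ 𝒞, C) = R ∧
  ∀ C ∈ 𝒞, ∀ D ∈ 𝒞, IsFace C (C ∩ D) ∧ IsFace D (C ∩ D)

/-- The standard simplex `Δ^n_0 = conv{0, e_1, …, e_n} ⊆ ℝ^n`. -/
def stdSimplexPoly (n : ℕ) : Set (Fin n → ℝ) :=
  convexHull ℝ ({0} ∪ Set.range (fun i : Fin n => fun j => if j = i then (1 : ℝ) else 0))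

def dotL {n : ℕ} (c : Fin n → ℝ) : Module.Dual ℝ (Fin n → ℝ) where
  toFun x := dotR c x
  map_add' x y := by simp [dotR, mul_add, Finset.sum_add_distrib]
  map_smul' r x := by
    simp only [dotR, Finset.mul_sum, Pi.smul_apply, smul_eq_mul, RingHom.id_apply]
    exact Finset.sum_congr rfl fun i _ => by ring

lemma dotL_apply {n : ℕ} (c x : Fin n → ℝ) : dotL c x = dotR c x := rfl

lemma dotR_comm' {n : ℕ} (c x : Fin n → ℝ) : dotR c x = dotR x c := by
  simp [dotR, mul_comm]

lemma dotR_add_left' {n : ℕ} (c d x : Fin n → ℝ) : dotR (c + d) x = dotR c x + dotR d x := by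
  simp [dotR, add_mul, Finset.sum_add_distrib]

lemma dotR_snoc' {n : ℕ} (c x : Fin n → ℝ) (a b : ℝ) :
    dotR (Fin.snoc c a : Fin (n + 1) → ℝ) (Fin.snoc x b) = dotR c x + a * b := by
  simp [dotR, Fin.sum_univ_castSucc]

/-- the lifting map -/
def liftA {n : ℕ} (α : Fin n → ℝ) (β : ℝ) : (Fin n → ℝ) →ᵃ[ℝ] (Fin (n + 1) → ℝ) where
  toFun x := Fin.snoc x (dotR α x + β)
  linear :=
    { toFun := fun x => Fin.snoc x (dotL α x)
      map_add' := fun x y => by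
        ext i
        refine Fin.lastCases ?_ (fun j => ?_) i <;> simp
      map_smul' := fun r x => by
        ext i
        refine Fin.lastCases ?_ (fun j => ?_) i <;> simp }
  map_vadd' x v := by
    ext i
    refine Fin.lastCases ?_ (fun j => ?_) i
    · simp [← dotL_apply]; ring
    · simp

lemma liftA_apply {n : ℕ} (α : Fin n → ℝ) (β : ℝ) (x : Fin n → ℝ) :
    liftA α β x = Fin.snoc x (dotR α x + β) := rfl

lemma argmin_lift {n : ℕ} (α : Fin n → ℝ) (β : ℝ) (c : Fin n → ℝ) (Q : Set (Fin n → ℝ)) :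
    argminSet (Fin.snoc c 1) ((fun q => (Fin.snoc q (dotR α q + β) : Fin (n + 1) → ℝ)) '' Q)
      = liftA α β '' argminSet (c + α) Q := by
  have key : ∀ q, dotR (Fin.snoc c 1 : Fin (n + 1) → ℝ) (Fin.snoc q (dotR α q + β))
      = dotR (c + α) q + β := by
    intro q
    rw [dotR_snoc', dotR_add_left']; ring
  ext z
  constructor
  · rintro ⟨⟨q, hq, rfl⟩, h⟩
    refine ⟨q, ⟨hq, fun y hy => ?_⟩, rfl⟩
    have := h _ ⟨y, hy, rfl⟩
    simp only [key] at this
    linarith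
  · rintro ⟨q, ⟨hq, h⟩, rfl⟩
    refine ⟨⟨q, hq, rfl⟩, ?_⟩
    rintro _ ⟨y, hy, rfl⟩
    have := h y hy
    simp only [liftA_apply, key]
    linarith

lemma argmin_hull {n : ℕ} (V : Finset (Fin n → ℝ)) (c : Fin n → ℝ) :
    ∃ S : Finset (Fin n → ℝ), S ⊆ V ∧
      argminSet c (convexHull ℝ (V : Set (Fin n → ℝ))) = convexHull ℝ (S : Set (Fin n → ℝ)) := by
  classical
  refine ⟨V.filter (fun v => v ∈ argminSet c (convexHull ℝ (V : Set (Fin n → ℝ)))),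
    Finset.filter_subset _ _, ?_⟩
  apply Set.Subset.antisymm
  · rintro x ⟨hx, hmin⟩
    obtain ⟨w, hw0, hw1, hwx⟩ := Finset.mem_convexHull'.1 hx
    have hz : ∑ v ∈ V, w v * (dotR c v - dotR c x) = 0 := by
      have h1 : dotR c x = ∑ v ∈ V, w v * dotR c v := by
        conv_lhs => rw [← hwx, ← dotL_apply]
        simp [map_sum, dotL_apply]
      simp only [mul_sub, Finset.sum_sub_distrib, ← Finset.sum_mul, hw1, ← h1]
      ring
    have hz' := (Finset.sum_eq_zero_iff_of_nonneg (fun v hv => mul_nonneg (hw0 v hv)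
      (sub_nonneg.2 (hmin v (subset_convexHull ℝ _ hv))))).1 hz
    have hne : ∀ v ∈ V, w v ≠ 0 → v ∈ argminSet c (convexHull ℝ (V : Set (Fin n → ℝ))) := by
      intro v hv hwv
      have : dotR c v = dotR c x := by
        have := (mul_eq_zero.1 (hz' v hv)).resolve_left hwv
        linarith
      exact ⟨subset_convexHull ℝ _ hv, fun y hy => this ▸ hmin y hy⟩
    refine Finset.mem_convexHull'.2 ⟨w, fun v hv => hw0 v (Finset.mem_filter.1 hv).1, ?_, ?_⟩
    · rw [← hw1]
      exact Finset.sum_filter_of_ne hne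
    · rw [← hwx]
      exact Finset.sum_filter_of_ne fun v hv h => hne v hv fun h0 => h (by simp [h0])
  · apply convexHull_min
    · intro v hv
      exact (Finset.mem_filter.1 hv).2
    · rintro x ⟨hx, hx'⟩ y ⟨hy, hy'⟩ a b ha hb hab
      refine ⟨convex_convexHull ℝ _ hx hy ha hb hab, fun z hz => ?_⟩
      have e : dotR c (a • x + b • y) = a * dotR c x + b * dotR c y := by
        simp only [← dotL_apply, map_add, map_smul, smul_eq_mul]
      rw [e]
      have h1 := mul_le_mul_of_nonneg_left (hx' z hz) ha
      have h2 := mul_le_mul_of_nonneg_left (hy' z hz) hb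
      have h3 : a * dotR c z + b * dotR c z = dotR c z := by rw [← add_mul, hab, one_mul]
      linarith

lemma faces_finite {n : ℕ} {P : Set (Fin n → ℝ)} (hP : IsPolytope P) :
    (Set.range fun c => argminSet c P).Finite := by
  obtain ⟨V, -, rfl⟩ := hP
  refine (V.powerset.finite_toSet.image
    (fun S : Finset (Fin n → ℝ) => convexHull ℝ (S : Set (Fin n → ℝ)))).subset ?_
  rintro _ ⟨c, rfl⟩
  obtain ⟨S, hS, h⟩ := argmin_hull V c
  exact ⟨S, by simpa using hS, h.symm⟩

lemma dot_direction {n : ℕ} {P : Set (Fin n → ℝ)} {c u : Fin n → ℝ}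
    (hu : u ∈ (affineSpan ℝ (argminSet c P)).direction) : dotR c u = 0 := by
  rw [direction_affineSpan, vectorSpan_def] at hu
  have : Submodule.span ℝ (argminSet c P -ᵥ argminSet c P) ≤ LinearMap.ker (dotL c) := by
    rw [Submodule.span_le]
    rintro _ ⟨x, hx, y, hy, rfl⟩
    have := le_antisymm (hx.2 y hy.1) (hy.2 x hx.1)
    rw [← dotL_apply, ← dotL_apply] at this
    simp [this]
  exact this hu

lemma exists_alpha {n : ℕ} (P Q : Set (Fin n → ℝ))
    (hP : IsPolytope P) (hQ : IsPolytope Q) :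
    ∃ α : Fin n → ℝ, ∀ c : Fin n → ℝ, (affineSpan ℝ (argminSet c P)).direction ⊓
        (affineSpan ℝ (argminSet (c + α) Q)).direction = ⊥ := by
  let ι := {p : Set (Fin n → ℝ) × Set (Fin n → ℝ) //
    p ∈ (Set.range fun c => argminSet c P) ×ˢ (Set.range fun c => argminSet c Q) ∧
      (affineSpan ℝ p.1).direction ⊓ (affineSpan ℝ p.2).direction ≠ ⊥}
  have : Finite ι :=
    (((faces_finite hP).prod (faces_finite hQ)).subset fun p hp => hp.1 : Set.Finite
      {p : Set (Fin n → ℝ) × Set (Fin n → ℝ) |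
    p ∈ (Set.range fun c => argminSet c P) ×ˢ (Set.range fun c => argminSet c Q) ∧
      (affineSpan ℝ p.1).direction ⊓ (affineSpan ℝ p.2).direction ≠ ⊥})
  have hex : ∀ i : ι, ∃ u, u ∈ (affineSpan ℝ i.1.1).direction ⊓ (affineSpan ℝ i.1.2).direction ∧
      u ≠ 0 := fun i => Submodule.exists_mem_ne_zero_of_ne_bot i.2.2
  choose u hu hu0 using hex
  obtain ⟨α, hα⟩ := Module.Dual.exists_forall_ne_zero_of_forall_exists
    (fun i => dotL (u i)) (fun i => by
      by_contra! h
      apply hu0 i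
      have := h (u i)
      simp only [dotL_apply, dotR] at this
      rw [Finset.sum_eq_zero_iff_of_nonneg (fun j _ => mul_self_nonneg _)] at this
      ext j
      simpa using this j (Finset.mem_univ j))
  refine ⟨α, fun c => ?_⟩
  by_contra hne
  let i : ι := ⟨(argminSet c P, argminSet (c + α) Q), ⟨⟨c, rfl⟩, ⟨c + α, rfl⟩⟩, hne⟩
  have h1 : dotR c (u i) = 0 := dot_direction (hu i).1
  have h2 : dotR (c + α) (u i) = 0 := dot_direction (hu i).2
  rw [dotR_add_left', h1, zero_add, dotR_comm'] at h2
  exact hα i h2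

lemma exists_beta {n : ℕ} (P Q : Set (Fin n → ℝ))
    (hP : IsPolytope P) (hQ : IsPolytope Q) (α : Fin n → ℝ) :
    ∃ β : ℝ, ∀ c d : Fin n → ℝ, (affineSpan ℝ (argminSet c P)).direction ⊓
        (affineSpan ℝ (argminSet d Q)).direction = ⊥ →
      ∀ x ∈ affineSpan ℝ (argminSet c P), x ∈ affineSpan ℝ (argminSet d Q) →
        dotR α x + β ≠ 0 := by
  let B : Set (Fin n → ℝ) × Set (Fin n → ℝ) → Set ℝ := fun p =>
    {b | (affineSpan ℝ p.1).direction ⊓ (affineSpan ℝ p.2).direction = ⊥ ∧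
      ∃ x ∈ affineSpan ℝ p.1, x ∈ affineSpan ℝ p.2 ∧ b = - dotR α x}
  have hfin : (⋃ p ∈ (Set.range fun c => argminSet c P) ×ˢ (Set.range fun c => argminSet c Q),
      B p).Finite := by
    refine ((faces_finite hP).prod (faces_finite hQ)).biUnion fun p _ => ?_
    apply Set.Subsingleton.finite
    rintro _ ⟨h, x, hx1, hx2, rfl⟩ _ ⟨-, y, hy1, hy2, rfl⟩
    have : x -ᵥ y ∈ (affineSpan ℝ p.1).direction ⊓ (affineSpan ℝ p.2).direction :=
      ⟨AffineSubspace.vsub_mem_direction hx1 hy1, AffineSubspace.vsub_mem_direction hx2 hy2⟩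
    rw [h, Submodule.mem_bot, vsub_eq_zero_iff_eq] at this
    rw [this]
  obtain ⟨β, hβ⟩ := hfin.infinite_compl.nonempty
  refine ⟨β, fun c d h x hx hx' h0 => hβ ?_⟩
  refine Set.mem_biUnion (x := (argminSet c P, argminSet d Q)) ⟨⟨c, rfl⟩, ⟨d, rfl⟩⟩ ?_
  exact ⟨h, x, hx, hx', by linarith⟩

/-- Generic choice of the lifting parameters: for polytopes `P, Q ⊆ ℝ^n` there are
`α ∈ ℝ^n`, `β ∈ ℝ` such that for every `c ≠ 0` the faces `F_c = argmin_P c` and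
`G_c = argmin_Q (c + α)` satisfy `Lin F_c ∩ Lin G_c = {0}`, and the affine hulls of the
lower faces `F⁰_c` of `P⁰` and `G^{α,β}_c` of `Q^{α,β}` (lifted to `ℝ^{n+1}`) are disjoint. -/
theorem generic_lifting_parameters {n : ℕ} (P Q : Set (Fin n → ℝ))
    (hP : IsPolytope P) (hQ : IsPolytope Q) :
    ∃ (α : Fin n → ℝ) (β : ℝ), ∀ c : Fin n → ℝ, c ≠ 0 →
      ((affineSpan ℝ (argminSet c P)).direction ⊓
        (affineSpan ℝ (argminSet (c + α) Q)).direction = ⊥) ∧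
      ((affineSpan ℝ (argminSet (Fin.snoc c 1)
          ((fun p => Fin.snoc p (0 : ℝ)) '' P)) : Set (Fin (n + 1) → ℝ)) ∩
        (affineSpan ℝ (argminSet (Fin.snoc c 1)
          ((fun q => Fin.snoc q (dotR α q + β)) '' Q)) : Set (Fin (n + 1) → ℝ)) = ∅) := by
  obtain ⟨α, hα⟩ := exists_alpha P Q hP hQ
  obtain ⟨β, hβ⟩ := exists_beta P Q hP hQ α
  refine ⟨α, β, fun c _ => ⟨hα c, ?_⟩⟩
  have e0 : (fun p : Fin n → ℝ => (Fin.snoc p (0 : ℝ) : Fin (n + 1) → ℝ)) =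
      fun p => (Fin.snoc p (dotR 0 p + 0) : Fin (n + 1) → ℝ) := by
    funext p; simp [dotR]
  rw [e0, argmin_lift, argmin_lift, ← AffineSubspace.map_span, ← AffineSubspace.map_span, add_zero]
  rw [Set.eq_empty_iff_forall_notMem]
  rintro z ⟨⟨x, hx, rfl⟩, ⟨y, hy, hxy⟩⟩
  have hxy' : (Fin.snoc y (dotR α y + β) : Fin (n + 1) → ℝ) = Fin.snoc x (dotR 0 x + 0) := hxy
  obtain ⟨rfl, h2⟩ := Fin.snoc_injective2 hxy'
  refine hβ c (c + α) (hα c) y hx hy ?_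
  rw [h2]; simp [dotR]

end
end

section
/- Fix k ∈ N and let Q_k be the class of lattice polytopes all of whose faces of dimension at least 2^k have even normalized volume. If P, Q ∈ Q_k are lattice polytopes in R^n, then their Minkowski sum P + Q is again in Q_k. -/
open Pointwise MeasureTheory

noncomputable section

section weights
variable {J E : Type*} [Fintype J] [AddCommGroup E] [Module ℝ E]

lemma mem_hull_weights (z : J → E) (S : Finset J) (x : E) :
    x ∈ convexHull ℝ (z '' (S : Set J)) ↔ ∃ l : J → ℝ, (∀ j, 0 ≤ l j) ∧ (∀ j, j ∉ S → l j = 0) ∧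
      ∑ j, l j = 1 ∧ ∑ j, l j • z j = x := by
  classical
  constructor
  · intro hx
    have hsub : z '' (S : Set J) ⊆ {x | ∃ l : J → ℝ, (∀ j, 0 ≤ l j) ∧ (∀ j, j ∉ S → l j = 0) ∧
      ∑ j, l j = 1 ∧ ∑ j, l j • z j = x} := by
      rintro _ ⟨j, hj, rfl⟩
      refine ⟨fun i => if i = j then 1 else 0, fun i => by dsimp only; split_ifs <;> norm_num, ?_, by simp,
        by simp⟩
      intro i hi
      dsimp only
      rw [if_neg]
      rintro rfl
      exact hi hj
    refine convexHull_min hsub ?_ hx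
    rintro a ⟨l, h1, h2, h3, rfl⟩ b ⟨m, g1, g2, g3, rfl⟩ s t hs ht hst
    refine ⟨fun j => s * l j + t * m j, fun j => ?_, fun j hj => ?_, ?_, ?_⟩
    · have := h1 j; have := g1 j; positivity
    · simp [h2 j hj, g2 j hj]
    · rw [Finset.sum_add_distrib, ← Finset.mul_sum, ← Finset.mul_sum, h3, g3]; linarith
    · simp only [add_smul, mul_smul, Finset.sum_add_distrib, Finset.smul_sum]
  · rintro ⟨l, h1, h2, h3, rfl⟩
    have e1 : ∑ j ∈ S, l j = 1 := by
      rw [← h3]; exact Finset.sum_subset (Finset.subset_univ _) (fun j _ hj => h2 j hj)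
    have e2 : ∑ j ∈ S, l j • z j = ∑ j, l j • z j :=
      Finset.sum_subset (Finset.subset_univ _) (fun j _ hj => by simp [h2 j hj])
    rw [← e2]
    refine (convex_convexHull ℝ _).sum_mem (fun j _ => h1 j) e1 (fun j hj => ?_)
    exact subset_convexHull ℝ _ ⟨j, hj, rfl⟩

lemma weights_support (l g : J → ℝ) (m : ℝ) (h0 : ∀ j, 0 ≤ l j) (h1 : ∑ j, l j = 1)
    (hg : ∀ j, m ≤ g j) (hm : ∑ j, l j * g j ≤ m) (j : J) (hj : l j ≠ 0) : g j = m := by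
  have h2 : ∑ j, l j * (g j - m) ≤ 0 := by
    simp only [mul_sub, Finset.sum_sub_distrib, ← Finset.sum_mul, h1]; linarith
  have h3 : ∀ i ∈ Finset.univ, 0 ≤ l i * (g i - m) := fun i _ =>
    mul_nonneg (h0 i) (by linarith [hg i])
  have h4 := (Finset.sum_eq_zero_iff_of_nonneg h3).1 (le_antisymm h2 (Finset.sum_nonneg h3)) j
    (Finset.mem_univ j)
  rcases mul_eq_zero.1 h4 with h | h
  · exact absurd h hj
  · linarith

open Classical in
/-- indices of the points minimizing the lifted functional -/
def cellSet (z : J → E) (ω : J → ℝ) (c : E →ₗ[ℝ] ℝ) : Finset J :=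
  Finset.univ.filter (fun j => ∀ i, c (z j) + ω j ≤ c (z i) + ω i)

open Classical in
/-- full-dimensional cells of the regular subdivision -/
def cells (z : J → E) (ω : J → ℝ) : Finset (Finset J) :=
  Finset.univ.filter (fun S => affineSpan ℝ (z '' (S : Set J)) = ⊤ ∧ ∃ c, S = cellSet z ω c)

lemma mem_cellSet (z : J → E) (ω : J → ℝ) (c : E →ₗ[ℝ] ℝ) (j : J) :
    j ∈ cellSet z ω c ↔ ∀ i, c (z j) + ω j ≤ c (z i) + ω i := by
  simp [cellSet]

lemma mem_cells (z : J → E) (ω : J → ℝ) (S : Finset J) :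
    S ∈ cells z ω ↔ affineSpan ℝ (z '' (S : Set J)) = ⊤ ∧ ∃ c, S = cellSet z ω c := by
  simp [cells]

lemma sum_lift (z : J → E) (ω : J → ℝ) (c : E →ₗ[ℝ] ℝ) (l : J → ℝ) :
    ∑ j, l j * (c (z j) + ω j) = c (∑ j, l j • z j) + ∑ j, l j * ω j := by
  simp [mul_add, Finset.sum_add_distrib, map_sum]

/-- A linear functional constant on a set with full affine span vanishes. -/
lemma linear_eq_zero_of_const {c : E →ₗ[ℝ] ℝ} {s : Set E} (hs : affineSpan ℝ s = ⊤) (m : ℝ)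
    (h : ∀ x ∈ s, c x = m) : c = 0 := by
  have h1 : ∀ x ∈ affineSpan ℝ s, c x = m := by
    intro x hx
    refine affineSpan_induction (p := fun x => c x = m) hx h ?_
    intro t u v w hu hv hw
    simp [hu, hv, hw]
  rw [hs] at h1
  ext x
  have := h1 x trivial
  have := h1 0 trivial
  simp at *
  linarith

lemma cell_inter (z : J → E) (ω : J → ℝ) {S T : Finset J} (hS : S ∈ cells z ω)
    (hT : T ∈ cells z ω) (hST : S ≠ T) {x : E} (hxS : x ∈ convexHull ℝ (z '' (S : Set J)))
    (hxT : x ∈ convexHull ℝ (z '' (T : Set J))) :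
    ∃ U : Finset J, affineSpan ℝ (z '' (U : Set J)) ≠ ⊤ ∧ x ∈ affineSpan ℝ (z '' (U : Set J)) := by
  classical
  obtain ⟨-, c, rfl⟩ := (mem_cells _ _ _).1 hS
  obtain ⟨-, d, rfl⟩ := (mem_cells _ _ _).1 hT
  obtain ⟨l, l0, lS, l1, lx⟩ := (mem_hull_weights _ _ _).1 hxS
  obtain ⟨m, m0, mT, m1, mx⟩ := (mem_hull_weights _ _ _).1 hxT
  have key : ∀ (c d : E →ₗ[ℝ] ℝ) (l m : J → ℝ), (∀ j, 0 ≤ l j) → (∑ j, l j = 1) →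
     (∑ j, l j • z j = x) → (∀ j, 0 ≤ m j) → (∀ j, j ∉ cellSet z ω d → m j = 0) → (∑ j, m j = 1) →
     (∑ j, m j • z j = x) → ∑ j, m j * ω j ≤ ∑ j, l j * ω j := by
    intro c d l m l0 l1 lx m0 mT m1 mx
    obtain ⟨j0, hj0⟩ : ∃ j, m j ≠ 0 := by
      by_contra! h
      simp [h] at m1
    have hj0 : j0 ∈ cellSet z ω d := by
      by_contra h
      exact hj0 (mT _ h)
    rw [mem_cellSet] at hj0
    have e1 : ∑ j, m j * (d (z j) + ω j) ≤ ∑ j, m j * (d (z j0) + ω j0) := by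
      refine Finset.sum_le_sum fun j _ => ?_
      by_cases hj : j ∈ cellSet z ω d
      · exact mul_le_mul_of_nonneg_left ((mem_cellSet _ _ _ _).1 hj j0) (m0 j)
      · simp [mT j hj]
    have e2 : ∑ j, l j * (d (z j0) + ω j0) ≤ ∑ j, l j * (d (z j) + ω j) :=
      Finset.sum_le_sum fun j _ => mul_le_mul_of_nonneg_left (hj0 j) (l0 j)
    rw [← Finset.sum_mul, l1, sum_lift, lx] at e2
    rw [← Finset.sum_mul, m1, sum_lift, mx] at e1
    linarith
  have hh := key d c m l m0 m1 mx l0 lS l1 lx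
  have hsupp : ∀ j, m j ≠ 0 → j ∈ cellSet z ω c := by
    obtain ⟨j0, hj0⟩ : ∃ j, l j ≠ 0 := by
      by_contra! h
      simp [h] at l1
    have hj0 : j0 ∈ cellSet z ω c := by
      by_contra h
      exact hj0 (lS _ h)
    rw [mem_cellSet] at hj0
    intro j hj
    have hh2 := key c d l m l0 l1 lx m0 mT m1 mx
    have e3 : ∑ j, m j * (c (z j) + ω j) ≤ c (z j0) + ω j0 := by
      have e1 : ∑ j, l j * (c (z j0) + ω j0) ≥ ∑ j, l j * (c (z j) + ω j) := by
        refine Finset.sum_le_sum fun j _ => ?_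
        by_cases hj : j ∈ cellSet z ω c
        · exact mul_le_mul_of_nonneg_left ((mem_cellSet _ _ _ _).1 hj j0) (l0 j)
        · simp [lS j hj]
      rw [← Finset.sum_mul, l1, sum_lift, lx] at e1
      rw [sum_lift, mx]
      linarith
    have := weights_support m (fun j => c (z j) + ω j) _ m0 m1 hj0 e3 j hj
    rw [mem_cellSet]
    intro i
    rw [this]; exact hj0 i
  refine ⟨cellSet z ω c ∩ cellSet z ω d, ?_, ?_⟩
  · intro htop
    apply hST
    have hcd : c - d = 0 := by
      obtain ⟨j0, hj0⟩ : ∃ j, m j ≠ 0 := by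
        by_contra! h
        simp [h] at m1
      have hj1 := hsupp _ hj0
      have hj2 : j0 ∈ cellSet z ω d := by
        by_contra h
        exact hj0 (mT _ h)
      rw [mem_cellSet] at hj1 hj2
      refine linear_eq_zero_of_const htop (c (z j0) - d (z j0)) ?_
      rintro _ ⟨j, hj, rfl⟩
      simp only [Finset.coe_inter, Set.mem_inter_iff, Finset.mem_coe, mem_cellSet] at hj
      have := hj1 j; have := hj2 j; have := hj.1 j0; have := hj.2 j0
      simp only [LinearMap.sub_apply]
      linarith
    rw [sub_eq_zero.1 hcd]
  · refine convexHull_subset_affineSpan _ ?_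
    rw [mem_hull_weights]
    refine ⟨m, m0, fun j hj => ?_, m1, mx⟩
    by_contra h
    apply hj
    rw [Finset.mem_inter]
    refine ⟨hsupp _ h, ?_⟩
    by_contra h'
    exact h (mT _ h')

end weights

section cover
variable {J E : Type*} [Fintype J] [NormedAddCommGroup E] [NormedSpace ℝ E] [FiniteDimensional ℝ E]

lemma cell_cover (z : J → E) (ω : J → ℝ) (hfull : affineSpan ℝ (Set.range z) = ⊤) {x : E}
    (hx : x ∈ convexHull ℝ (Set.range z))
    (hgen : ∀ U : Finset J, x ∈ affineSpan ℝ (z '' (U : Set J)) →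
      affineSpan ℝ (z '' (U : Set J)) = ⊤) :
    ∃ S ∈ cells z ω, x ∈ convexHull ℝ (z '' (S : Set J)) := by
  classical
  set K : Set (E × ℝ) := convexHull ℝ (Set.range (fun j => (z j, ω j))) with hK
  have Kc : Convex ℝ K := convex_convexHull ℝ _
  have Kcomp : IsCompact K := (Set.finite_range _).isCompact_convexHull ℝ
  have Kproj : Prod.fst '' K = convexHull ℝ (Set.range z) := by
    have := (LinearMap.fst ℝ E ℝ).image_convexHull (Set.range (fun j => (z j, ω j)))
    rw [← Set.range_comp] at this
    exact this
  obtain ⟨t0, ht0⟩ : ∃ t0, (x, t0) ∈ K := by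
    obtain ⟨⟨x', t0⟩, ht0, hx'⟩ : x ∈ Prod.fst '' K := Kproj ▸ hx
    simp only at hx'
    exact ⟨t0, hx' ▸ ht0⟩
  obtain ⟨h, hhK, hmin'⟩ : ∃ h, (x, h) ∈ K ∧ ∀ t, (x, t) ∈ K → h ≤ t := by
    obtain ⟨⟨x', h⟩, ⟨hhK, hx'⟩, hmin⟩ : ∃ p ∈ K ∩ Prod.fst ⁻¹' {x}, IsMinOn Prod.snd (K ∩ Prod.fst ⁻¹' {x}) p :=
      (Kcomp.inter_right (isClosed_singleton.preimage continuous_fst)).exists_isMinOn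
        ⟨(x, t0), ht0, rfl⟩ continuous_snd.continuousOn
    simp only [Set.mem_preimage, Set.mem_singleton_iff] at hx'
    exact ⟨h, hx' ▸ hhK, fun t ht => hmin ⟨ht, rfl⟩⟩
  set K' : Set (E × ℝ) := {p | ∃ t ≤ p.2, (p.1, t) ∈ K} with hK'
  have K'c : Convex ℝ K' := by
    rintro ⟨y, s⟩ ⟨s', hs', hs⟩ ⟨w, r⟩ ⟨r', hr', hr⟩ a b ha hb hab
    refine ⟨a * s' + b * r', ?_, ?_⟩
    · simp only [Prod.smul_mk, Prod.mk_add_mk, smul_eq_mul] at *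
      gcongr
    · have := Kc hs hr ha hb hab
      simpa using this
  have hKK' : K ⊆ K' := fun p hp => ⟨p.2, le_rfl, hp⟩
  have hnot : (x, h) ∉ interior K' := by
    intro hi
    have h1 : K' ∈ nhds (x, h) := mem_interior_iff_mem_nhds.1 hi
    have h2 : ∀ᶠ s in nhds h, (x, s) ∈ K' :=
      (Continuous.prodMk_right x).continuousAt.eventually h1
    obtain ⟨s, hs1, hs2⟩ := (((h2.filter_mono nhdsWithin_le_nhds).and
      (self_mem_nhdsWithin : Set.Iio h ∈ nhdsWithin h (Set.Iio h)))).exists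
    obtain ⟨t, ht1, ht2⟩ := hs1
    have := hmin' t ht2
    simp only [Set.mem_Iio] at hs2 ht1
    linarith
  obtain ⟨j0⟩ : Nonempty J := by
    by_contra hne
    rw [not_nonempty_iff] at hne
    rw [Set.range_eq_empty, convexHull_empty] at hx
    exact hx
  have hzK : ∀ j, (z j, ω j) ∈ K := fun j => subset_convexHull ℝ _ ⟨j, rfl⟩
  have hint : (interior K').Nonempty := by
    rw [K'c.interior_nonempty_iff_affineSpan_eq_top]
    rw [eq_top_iff]
    rintro ⟨y, t⟩ -
    have hy : y ∈ (affineSpan ℝ K').map (AffineMap.fst : E × ℝ →ᵃ[ℝ] E) := by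
      rw [AffineSubspace.map_span]
      have : (⊤ : AffineSubspace ℝ E) ≤ affineSpan ℝ ((AffineMap.fst : E × ℝ →ᵃ[ℝ] E) '' K') := by
        rw [← hfull]
        apply affineSpan_mono
        rintro _ ⟨j, rfl⟩
        exact ⟨_, hKK' (hzK j), rfl⟩
      exact this trivial
    obtain ⟨⟨y', s⟩, hs, hy'⟩ := hy
    simp only [AffineMap.coe_fst] at hy'
    subst hy'
    have v1 : (z j0, ω j0 + 1) ∈ affineSpan ℝ K' :=
      subset_affineSpan ℝ _ ⟨ω j0, by simp, hzK j0⟩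
    have v0 : (z j0, ω j0) ∈ affineSpan ℝ K' :=
      subset_affineSpan ℝ _ (hKK' (hzK j0))
    have := (affineSpan ℝ K').smul_vsub_vadd_mem (t - s) v1 v0 hs
    simpa using this
  obtain ⟨f, f0, hf⟩ := geometric_hahn_banach_of_nonempty_interior_point K'c hnot hint
  set γ : ℝ := f (0, 1) with hγ
  set c' : E →ₗ[ℝ] ℝ := (f : E × ℝ →ₗ[ℝ] ℝ) ∘ₗ LinearMap.inl ℝ E ℝ with hc'
  have hfe : ∀ y t, f (y, t) = c' y + t * γ := by
    intro y t
    have : (y, t) = (y, 0) + t • ((0 : E), (1 : ℝ)) := by simp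
    rw [this, map_add, map_smul]
    simp [hc', hγ]
  have hγ0 : γ ≤ 0 := by
    have h1 := hf (x, h + 1) ⟨h, by simp, hhK⟩
    rw [hfe, hfe] at h1
    linarith
  have hxr : (x, h) ∈ convexHull ℝ ((fun j => (z j, ω j)) '' ((Finset.univ : Finset J) : Set J)) := by
    rw [Finset.coe_univ, Set.image_univ]; exact hhK
  obtain ⟨l, l0, -, l1, lx⟩ := (mem_hull_weights _ _ _).1 hxr
  have lx1 : ∑ j, l j • z j = x := by
    have := congrArg Prod.fst lx
    simpa [Prod.fst_sum] using this
  have lx2 : ∑ j, l j * ω j = h := by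
    have := congrArg Prod.snd lx
    simpa [Prod.snd_sum] using this
  have hfj : ∀ j, c' (z j) + ω j * γ ≤ c' x + h * γ := by
    intro j
    have := hf _ (hKK' (hzK j))
    rwa [hfe, hfe] at this
  rcases hγ0.lt_or_eq with hneg | hzero
  · set c : E →ₗ[ℝ] ℝ := γ⁻¹ • c' with hc
    have hcj : ∀ j, c x + h ≤ c (z j) + ω j := by
      intro j
      have h1 := hfj j
      have h2 : γ⁻¹ * (c' x + h * γ) ≤ γ⁻¹ * (c' (z j) + ω j * γ) :=
        mul_le_mul_of_nonpos_left h1 (inv_nonpos.2 hneg.le)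
      have e : ∀ a b : ℝ, γ⁻¹ * (a + b * γ) = γ⁻¹ * a + b := by
        intro a b; have := hneg.ne; field_simp
      rw [e, e] at h2
      simpa [hc] using h2
    have hsupp := weights_support l (fun j => c (z j) + ω j) (c x + h) l0 l1 hcj
      (by rw [sum_lift, lx1, lx2])
    have hxS : x ∈ convexHull ℝ (z '' (cellSet z ω c : Set J)) := by
      rw [mem_hull_weights]
      refine ⟨l, l0, fun j hj => ?_, l1, lx1⟩
      by_contra hl
      apply hj
      rw [mem_cellSet]
      intro i
      exact (hsupp j hl).le.trans (hcj i)
    refine ⟨cellSet z ω c, ?_, hxS⟩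
    rw [mem_cells]
    exact ⟨hgen _ (convexHull_subset_affineSpan _ hxS), c, rfl⟩
  · exfalso
    have hsupp := weights_support l (fun j => - c' (z j)) (- c' x) l0 l1
      (fun j => by have := hfj j; simp [hzero] at this; linarith)
      (by
        have := sum_lift z (fun _ => 0) (-c') l
        simp only [LinearMap.neg_apply, add_zero, mul_zero, Finset.sum_const_zero] at this
        rw [this, lx1])
    set U : Finset J := Finset.univ.filter (fun j => c' (z j) = c' x) with hU
    have hxU : x ∈ convexHull ℝ (z '' (U : Set J)) := by
      rw [mem_hull_weights]
      refine ⟨l, l0, fun j hj => ?_, l1, lx1⟩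
      by_contra hl
      apply hj
      have := hsupp j hl
      simp only [hU, Finset.mem_filter, Finset.mem_univ, true_and]
      linarith
    have htop := hgen U (convexHull_subset_affineSpan _ hxU)
    have hc0 : c' = 0 := by
      refine linear_eq_zero_of_const htop (c' x) ?_
      rintro _ ⟨j, hj, rfl⟩
      simpa [hU] using hj
    apply f0
    refine ContinuousLinearMap.ext ?_
    rintro ⟨y, t⟩
    rw [hfe, hc0, hzero]
    simp

theorem vol_decomp [MeasurableSpace E] [BorelSpace E] (μ : Measure E) [μ.IsAddHaarMeasure]
    (z : J → E) (ω : J → ℝ) (hfull : affineSpan ℝ (Set.range z) = ⊤) :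
    μ (convexHull ℝ (Set.range z)) = ∑ S ∈ cells z ω, μ (convexHull ℝ (z '' (S : Set J))) := by
  classical
  set N : Set E := ⋃ U ∈ {U : Finset J | affineSpan ℝ (z '' (U : Set J)) ≠ ⊤},
    (affineSpan ℝ (z '' (U : Set J)) : Set E) with hN
  have hN0 : μ N = 0 := by
    rw [hN, measure_biUnion_null_iff (Set.toFinite _).countable]
    intro U hU
    apply Measure.addHaar_affineSubspace
    simpa using hU
  have hmemN : ∀ x, x ∈ N ↔ ∃ U : Finset J, affineSpan ℝ (z '' (U : Set J)) ≠ ⊤ ∧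
      x ∈ affineSpan ℝ (z '' (U : Set J)) := by
    intro x; simp [hN]
  rw [← measure_biUnion_finset₀]
  · apply le_antisymm
    · calc μ (convexHull ℝ (Set.range z)) ≤ μ ((⋃ S ∈ cells z ω, convexHull ℝ (z '' (S : Set J))) ∪ N) := by
            apply measure_mono
            intro x hx
            by_cases hxN : x ∈ N
            · exact Or.inr hxN
            · left
              rw [hmemN] at hxN
              push Not at hxN
              obtain ⟨S, hS, hxS⟩ := cell_cover z ω hfull hx (fun U hU => by
                by_contra hne
                exact hxN U hne hU)
              exact Set.mem_biUnion hS hxS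
        _ ≤ _ := by
            refine (measure_union_le _ _).trans ?_
            rw [hN0, add_zero]
    · apply measure_mono
      refine Set.iUnion₂_subset fun S hS => convexHull_mono (Set.image_subset_range _ _)
  · intro S hS T hT hST
    refine measure_mono_null ?_ hN0
    rintro x ⟨hxS, hxT⟩
    rw [hmemN]
    exact cell_inter z ω hS hT hST hxS hxT
  · intro S hS
    exact (((S.finite_toSet.image z).isCompact_convexHull ℝ).isClosed.measurableSet).nullMeasurableSet

end cover

section simplexvol

def cornerSimplex (d : ℕ) (s : ℝ) : Set (Fin d → ℝ) := {x | (∀ i, 0 ≤ x i) ∧ ∑ i, x i ≤ s}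

lemma isClosed_cornerSimplex (d : ℕ) (s : ℝ) : IsClosed (cornerSimplex d s) := by
  have : cornerSimplex d s = (⋂ i, {x | 0 ≤ x i}) ∩ {x | ∑ i, x i ≤ s} := by
    ext x; simp [cornerSimplex]
  rw [this]
  refine IsClosed.inter (isClosed_iInter fun i => ?_) ?_
  · exact isClosed_le continuous_const (continuous_apply i)
  · exact isClosed_le (by fun_prop) continuous_const

lemma volume_cornerSimplex (d : ℕ) : ∀ s : ℝ, 0 ≤ s →
    volume (cornerSimplex d s) = ENNReal.ofReal (s ^ d / d.factorial) := by
  induction d with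
  | zero =>
    intro s hs
    have : cornerSimplex 0 s = Set.univ := by
      ext x; simp [cornerSimplex, hs]
    rw [this, volume_pi, Measure.pi_univ]
    simp
  | succ d ih =>
    intro s hs
    have hmp := (volume_preserving_piFinSuccAbove (fun _ : Fin (d + 1) => ℝ) 0).symm
    rw [← hmp.measure_preimage (isClosed_cornerSimplex _ _).measurableSet.nullMeasurableSet]
    rw [Measure.volume_eq_prod, Measure.prod_apply
      (hmp.measurable (isClosed_cornerSimplex _ _).measurableSet)]
    have h1 : ∀ t : ℝ, volume (Prod.mk t ⁻¹'
        ((MeasurableEquiv.piFinSuccAbove (fun _ : Fin (d + 1) => ℝ) 0).symm ⁻¹'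
          cornerSimplex (d + 1) s)) =
        (Set.Icc 0 s).indicator (fun t => ENNReal.ofReal ((s - t) ^ d / d.factorial)) t := by
      intro t
      have h2 : (Prod.mk t ⁻¹'
        ((MeasurableEquiv.piFinSuccAbove (fun _ : Fin (d + 1) => ℝ) 0).symm ⁻¹'
          cornerSimplex (d + 1) s)) = {y | 0 ≤ t ∧ y ∈ cornerSimplex d (s - t)} := by
        ext y
        simp only [Set.mem_preimage, cornerSimplex, Set.mem_ofPred_eq, Fin.sum_univ_succ,
          Fin.forall_fin_succ, MeasurableEquiv.piFinSuccAbove_symm_apply, Fin.insertNthEquiv_apply,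
          Fin.insertNth_zero, Fin.cons_zero, Fin.cons_succ, and_assoc, le_sub_iff_add_le', cast_eq]
      rw [h2]
      by_cases ht : 0 ≤ t
      · by_cases hts : t ≤ s
        · rw [Set.indicator_of_mem (Set.mem_Icc.2 ⟨ht, hts⟩), ← ih _ (by linarith)]
          simp [ht]
        · rw [Set.indicator_of_notMem (by simp [hts])]
          convert measure_empty (μ := volume)
          ext y
          simp only [Set.mem_ofPred_eq, cornerSimplex, Set.mem_empty_iff_false, iff_false]
          rintro ⟨-, h3, h4⟩
          have := Finset.sum_nonneg (fun i (_ : i ∈ Finset.univ) => h3 i)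
          linarith
      · rw [Set.indicator_of_notMem (by simp [ht])]
        simp [ht]
    simp_rw [h1]
    rw [lintegral_indicator measurableSet_Icc, ← ofReal_integral_eq_lintegral_ofReal]
    · congr 1
      rw [integral_Icc_eq_integral_Ioc, ← intervalIntegral.integral_of_le hs,
        intervalIntegral.integral_div]
      rw [intervalIntegral.integral_comp_sub_left (fun x => x ^ d) s]
      simp only [sub_self, sub_zero, integral_pow, Nat.factorial_succ]
      push_cast
      field_simp
      simp
    · apply Continuous.integrableOn_Icc
      fun_prop
    · rw [Filter.EventuallyLE, ae_restrict_iff' measurableSet_Icc]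
      refine Filter.Eventually.of_forall fun t ht => ?_
      have : 0 ≤ s - t := by linarith [ht.2]
      simp only [Pi.zero_apply]
      positivity

lemma int_det {d : ℕ} (M : Matrix (Fin d) (Fin d) ℝ) (h : ∀ i j, ∃ m : ℤ, M i j = m) :
    ∃ m : ℤ, M.det = m := by
  choose N hN using h
  refine ⟨(Matrix.of N).det, ?_⟩
  have : M = (Matrix.of N).map (Int.castRingHom ℝ) := by
    ext i j; simp [hN]
  rw [this, ← RingHom.mapMatrix_apply, ← RingHom.map_det]
  simp

lemma simplex_int {d : ℕ} (p : Fin (d + 1) → Fin d → ℝ) (hp : ∀ j, IsIntPt (p j)) :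
    ∃ m : ℤ, (d.factorial : ℝ) * (volume (convexHull ℝ (Set.range p))).toReal = m := by
  set M : Matrix (Fin d) (Fin d) ℝ := Matrix.of fun i j => p j.succ i - p 0 i with hM
  have himg : convexHull ℝ (Set.range p) =
      (fun x => p 0 + x) '' ((Matrix.toLin' M) '' cornerSimplex d 1) := by
    ext x
    have := mem_hull_weights p Finset.univ x
    rw [Finset.coe_univ, Set.image_univ] at this
    rw [this]
    have hMx : ∀ y : Fin d → ℝ, Matrix.toLin' M y = ∑ i, y i • (p i.succ - p 0) := by
      intro y
      ext i
      simp [hM, Matrix.mulVec, dotProduct, Finset.sum_apply, mul_comm]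
    constructor
    · rintro ⟨l, l0, -, l1, rfl⟩
      refine ⟨_, ⟨fun i => l i.succ, ⟨fun i => l0 _, ?_⟩, rfl⟩, ?_⟩
      · rw [Fin.sum_univ_succ] at l1
        linarith [l0 0]
      · rw [Fin.sum_univ_succ] at l1
        simp only [hMx, Fin.sum_univ_succ (fun i => l i • p i), smul_sub, Finset.sum_sub_distrib,
          ← Finset.sum_smul]
        have : l 0 = 1 - ∑ i : Fin d, l i.succ := by linarith
        rw [this]
        module
    · rintro ⟨_, ⟨y, ⟨y0, y1⟩, rfl⟩, rfl⟩
      refine ⟨Fin.cons (1 - ∑ i, y i) y, ?_, by simp, by simp [Fin.sum_univ_succ], ?_⟩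
      · intro j
        refine Fin.cases ?_ (fun i => ?_) j
        · simp only [Fin.cons_zero]; linarith
        · simpa using y0 i
      · simp only [hMx, Fin.sum_univ_succ, Fin.cons_zero, Fin.cons_succ, smul_sub,
          Finset.sum_sub_distrib, ← Finset.sum_smul]
        module
  obtain ⟨m, hm⟩ := int_det M (fun i j => by
    obtain ⟨a, ha⟩ := hp j.succ i
    obtain ⟨b, hb⟩ := hp 0 i
    exact ⟨a - b, by simp [hM, ha, hb]⟩)
  refine ⟨|m|, ?_⟩
  rw [himg, Set.image_add_left, measure_preimage_add, Measure.addHaar_image_linearMap,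
    volume_cornerSimplex d 1 zero_le_one, ENNReal.toReal_mul, LinearMap.det_toLin', hm]
  rw [ENNReal.toReal_ofReal (abs_nonneg _), ENNReal.toReal_ofReal (by positivity)]
  push_cast
  have : (d.factorial : ℝ) ≠ 0 := by positivity
  field_simp
  simp

lemma exists_generic {J E : Type*} [Fintype J] [AddCommGroup E] [Module ℝ E] (z : J → E) :
    ∃ ω : J → ℝ, ∀ c, AffineIndependent ℝ (fun j : (cellSet z ω c) => z j) := by
  classical
  have hdep : ∀ S : {S : Finset J // ¬ AffineIndependent ℝ (fun j : S => z j)},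
      ∃ v : J → ℝ, v ≠ 0 ∧ (∀ j, j ∉ S.1 → v j = 0) ∧ ∑ j, v j = 0 ∧ ∑ j, v j • z j = 0 := by
    rintro ⟨S, hS⟩
    rw [affineIndependent_iff] at hS
    push Not at hS
    obtain ⟨s, w, h1, h2, i, hi, hwi⟩ := hS
    set v : J → ℝ := fun j => if h : ∃ hj : j ∈ S, (⟨j, hj⟩ : S) ∈ s then w ⟨j, h.1⟩ else 0 with hv
    have hvS : ∀ j : S, v j = if j ∈ s then w j else 0 := by
      intro j; simp [hv]
    have hv0 : ∀ j, j ∉ S → v j = 0 := by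
      intro j hj; simp [hv, hj]
    refine ⟨v, ?_, hv0, ?_, ?_⟩
    · intro h0
      have := congrFun h0 i.1
      rw [hvS, if_pos hi] at this
      exact hwi this
    · rw [← Finset.sum_subset (Finset.subset_univ S) (fun j _ hj => hv0 j hj), ← Finset.sum_coe_sort]
      simp only [hvS]
      rw [← Finset.sum_filter, Finset.filter_univ_mem]
      exact h1
    · rw [← Finset.sum_subset (Finset.subset_univ S) (fun j _ hj => by simp [hv0 j hj]),
        ← Finset.sum_coe_sort]
      simp only [hvS, ite_smul, zero_smul]
      rw [← Finset.sum_filter, Finset.filter_univ_mem]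
      exact h2
  choose v hv0 hvS hv1 hvz using hdep
  obtain ⟨f, hf⟩ := Module.exists_dual_forall_apply_ne_zero (K := ℝ) v hv0
  refine ⟨fun j => f (Pi.single j 1), fun c => ?_⟩
  set ω : J → ℝ := fun j => f (Pi.single j 1) with hω
  by_contra hS
  set S' : {S : Finset J // ¬ AffineIndependent ℝ (fun j : S => z j)} := ⟨cellSet z ω c, hS⟩ with hS'
  apply hf S'
  have h1 : f (v S') = ∑ j, v S' j * ω j := by
    conv_lhs => rw [pi_eq_sum_univ' (v S')]
    rw [map_sum]
    refine Finset.sum_congr rfl fun j _ => ?_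
    rw [map_smul]
    simp only [smul_eq_mul, hω]
  have h2 := sum_lift z ω c (v S')
  rw [hvz, map_zero, zero_add, ← h1] at h2
  rw [← h2]
  obtain ⟨j0, hj0⟩ : ∃ j, v S' j ≠ 0 := by
    by_contra! h
    exact hv0 S' (funext h)
  have hj1 : j0 ∈ cellSet z ω c := by
    by_contra h
    exact hj0 (hvS S' j0 h)
  have : ∀ j, v S' j * (c (z j) + ω j) = v S' j * (c (z j0) + ω j0) := by
    intro j
    by_cases hj : j ∈ cellSet z ω c
    · rw [mem_cellSet] at hj hj1
      rw [le_antisymm (hj j0) (hj1 j)]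
    · rw [hvS S' j hj]; simp
  simp_rw [this]
  rw [← Finset.sum_mul, hv1, zero_mul]

theorem vol_int {d : ℕ} {J : Type*} [Fintype J] (z : J → Fin d → ℝ) (hz : ∀ j, IsIntPt (z j))
    (hfull : affineSpan ℝ (Set.range z) = ⊤) :
    ∃ m : ℤ, (d.factorial : ℝ) * (volume (convexHull ℝ (Set.range z))).toReal = m := by
  classical
  obtain ⟨ω, hω⟩ := exists_generic z
  rw [vol_decomp volume z ω hfull, ENNReal.toReal_sum, Finset.mul_sum]
  · have : ∀ S ∈ cells z ω, ∃ m : ℤ,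
        (d.factorial : ℝ) * (volume (convexHull ℝ (z '' (S : Set J)))).toReal = m := by
      intro S hS
      obtain ⟨htop, c, rfl⟩ := (mem_cells _ _ _).1 hS
      have hind := hω c
      have hr : Set.range (fun j : (cellSet z ω c) => z j) = z '' (cellSet z ω c : Set J) := by
        ext x; simp
      have hcard : Fintype.card (cellSet z ω c) = d + 1 := by
        have := hind.affineSpan_eq_top_iff_card_eq_finrank_add_one.1 (by rw [hr]; exact htop)
        simpa using this
      set e := (Fintype.equivFinOfCardEq hcard).symm with he
      obtain ⟨m, hm⟩ := simplex_int (fun i => z (e i)) (fun j => hz _)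
      refine ⟨m, ?_⟩
      rw [← hm, ← hr, ← e.surjective.range_comp]
      rfl
    choose! m hm using this
    refine ⟨∑ S ∈ cells z ω, m S, ?_⟩
    push_cast
    exact Finset.sum_congr rfl hm
  · intro S _
    exact (((S.finite_toSet.image z).isCompact_convexHull ℝ).measure_lt_top).ne

end simplexvol

lemma IsIntPt.sub' {n : ℕ} {x y : Fin n → ℝ} (hx : IsIntPt x) (hy : IsIntPt y) : IsIntPt (x - y) := by
  intro i
  obtain ⟨a, ha⟩ := hx i
  obtain ⟨b, hb⟩ := hy i
  exact ⟨a - b, by simp [ha, hb]⟩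

lemma IsIntPt.add' {n : ℕ} {x y : Fin n → ℝ} (hx : IsIntPt x) (hy : IsIntPt y) : IsIntPt (x + y) := by
  intro i
  obtain ⟨a, ha⟩ := hx i
  obtain ⟨b, hb⟩ := hy i
  exact ⟨a + b, by simp [ha, hb]⟩

lemma int_toLin {m n : ℕ} (M : Matrix (Fin m) (Fin n) ℤ) (x : Fin n → ℝ) (hx : IsIntPt x) :
    IsIntPt (Matrix.toLin' (M.map (Int.cast : ℤ → ℝ)) x) := by
  intro i
  choose v hv using hx
  refine ⟨∑ j, M i j * v j, ?_⟩
  simp [Matrix.mulVec, dotProduct, hv]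

def castLin (n : ℕ) : (Fin n → ℤ) →ₗ[ℤ] (Fin n → ℝ) :=
  ((Int.castAddHom ℝ).toIntLinearMap).compLeft (Fin n)

lemma castLin_apply {n : ℕ} (v : Fin n → ℤ) (i : Fin n) : castLin n v i = (v i : ℝ) := rfl

lemma exists_frame_aux {n : ℕ} (D : Submodule ℝ (Fin n → ℝ)) (G : Set (Fin n → ℝ))
    (hG : ∀ g ∈ G, IsIntPt g) (hD : D = Submodule.span ℝ G) :
    ∃ (r : ℕ) (ι : (Fin r → ℝ) →ₗ[ℝ] (Fin n → ℝ)) (π : (Fin n → ℝ) →ₗ[ℝ] (Fin r → ℝ)),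
      (∀ t, π (ι t) = t) ∧ LinearMap.range ι = D ∧ (∀ t, IsIntPt t → IsIntPt (ι t)) ∧
      (∀ x, IsIntPt x → IsIntPt (π x)) := by
  classical
  set L : Submodule ℤ (Fin n → ℤ) := (D.restrictScalars ℤ).comap (castLin n) with hL
  obtain ⟨r, snf⟩ := L.smithNormalForm (Pi.basisFun ℤ (Fin n))
  set B : Matrix (Fin n) (Fin n) ℤ := (Pi.basisFun ℤ (Fin n)).toMatrix snf.bM with hB
  set C : Matrix (Fin n) (Fin n) ℤ := snf.bM.toMatrix (Pi.basisFun ℤ (Fin n)) with hC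
  have hCB : C * B = 1 := Module.Basis.toMatrix_mul_toMatrix_flip _ _
  have hBa : ∀ i j, B i j = snf.bM j i := by
    intro i j; simp [hB, Module.Basis.toMatrix_apply]
  set ι : (Fin r → ℝ) →ₗ[ℝ] (Fin n → ℝ) :=
    Matrix.toLin' ((B.submatrix id snf.f).map (Int.cast : ℤ → ℝ)) with hι
  set π : (Fin n → ℝ) →ₗ[ℝ] (Fin r → ℝ) :=
    Matrix.toLin' ((C.submatrix snf.f id).map (Int.cast : ℤ → ℝ)) with hπ
  have hιe : ∀ t, ι t = ∑ k, t k • castLin n (snf.bM (snf.f k)) := by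
    intro t
    ext i
    simp [hι, Matrix.mulVec, dotProduct, hBa, castLin_apply, mul_comm]
  refine ⟨r, ι, π, ?_, ?_, ?_, ?_⟩
  · intro t
    rw [hι, hπ, ← LinearMap.comp_apply, ← Matrix.toLin'_mul]
    have : (C.submatrix snf.f id).map (Int.cast : ℤ → ℝ) *
        (B.submatrix id snf.f).map (Int.cast : ℤ → ℝ) = 1 := by
      have h1 : (C.submatrix snf.f id) * (B.submatrix id snf.f) = 1 := by
        have := Matrix.submatrix_mul C B snf.f id snf.f Function.bijective_id
        rw [← this, hCB, Matrix.submatrix_one _ snf.f.injective]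
      have h2 := congrArg (fun M => Matrix.map M (Int.castRingHom ℝ)) h1
      simp only [Matrix.map_mul] at h2
      simpa using h2
    rw [this]
    simp
  · apply le_antisymm
    · rintro _ ⟨t, rfl⟩
      rw [hιe]
      refine Submodule.sum_mem _ fun k _ => Submodule.smul_mem _ _ ?_
      have h1 : (snf.bN k : Fin n → ℤ) ∈ L := (snf.bN k).2
      rw [snf.snf] at h1
      have ha : snf.a k ≠ 0 := by
        intro h0
        have h2 := snf.snf k
        rw [h0, zero_smul] at h2
        exact snf.bN.ne_zero k (Subtype.ext h2)
      have h3 : castLin n (snf.a k • snf.bM (snf.f k)) ∈ D := h1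
      have h4 : castLin n (snf.a k • snf.bM (snf.f k)) =
          (snf.a k : ℝ) • castLin n (snf.bM (snf.f k)) := by
        ext i; simp [castLin_apply]
      rw [h4] at h3
      exact (Submodule.smul_mem_iff _ (by exact_mod_cast ha)).1 h3
    · rw [hD, Submodule.span_le]
      intro g hg
      choose v hv using hG g hg
      have hgv : castLin n v = g := by ext i; simp [castLin_apply, hv]
      have hvL : v ∈ L := by
        change castLin n v ∈ D
        rw [hgv, hD]
        exact Submodule.subset_span hg
      have h1 := congrArg Subtype.val (snf.bN.sum_repr ⟨v, hvL⟩)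
      rw [AddSubmonoidClass.coe_finsetSum] at h1
      simp only [SetLike.val_smul, snf.snf] at h1
      refine ⟨fun k => (snf.bN.repr ⟨v, hvL⟩ k : ℝ) * snf.a k, ?_⟩
      rw [hιe, ← hgv]
      conv_rhs => rw [← h1]
      ext i
      simp [castLin_apply, Finset.sum_apply, mul_assoc]
  · exact fun t ht => int_toLin _ t ht
  · exact fun t ht => int_toLin _ t ht

lemma exists_frame {n : ℕ} (D : Submodule ℝ (Fin n → ℝ)) (G : Set (Fin n → ℝ))
    (hG : ∀ g ∈ G, IsIntPt g) (hD : D = Submodule.span ℝ G) (r : ℕ) (hr : Module.finrank ℝ D = r) :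
    ∃ (ι : (Fin r → ℝ) →ₗ[ℝ] (Fin n → ℝ)) (π : (Fin n → ℝ) →ₗ[ℝ] (Fin r → ℝ)),
      (∀ t, π (ι t) = t) ∧ LinearMap.range ι = D ∧ (∀ t, IsIntPt t → IsIntPt (ι t)) ∧
      (∀ x, IsIntPt x → IsIntPt (π x)) := by
  obtain ⟨r', ι, π, h1, h2, h3, h4⟩ := exists_frame_aux D G hG hD
  have : r' = r := by
    rw [← hr, ← h2, LinearMap.finrank_range_of_inj (Function.LeftInverse.injective h1)]
    simp
  subst this
  exact ⟨ι, π, h1, h2, h3, h4⟩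

lemma chart_le {n r : ℕ} {S : Set (Fin n → ℝ)} {φ ψ : (Fin n → ℝ) →ᵃ[ℝ] (Fin r → ℝ)}
    (hφ : IsLatticeChart S φ) (hψ : IsLatticeChart S ψ) :
    volume ((fun x => φ x) '' S) ≤ volume ((fun x => ψ x) '' S) := by
  set D := (affineSpan ℝ S).direction with hD
  obtain ⟨p, hp, hp0⟩ := hφ.1.surjOn (Set.mem_univ 0)
  simp only at hp0
  have key : ∀ χ : (Fin n → ℝ) →ᵃ[ℝ] (Fin r → ℝ), IsLatticeChart S χ →
      Function.Bijective (χ.linear ∘ₗ D.subtype) := by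
    intro χ hχ
    constructor
    · rw [← LinearMap.ker_eq_bot, LinearMap.ker_eq_bot']
      rintro ⟨v, hv⟩ h0
      have h1 : χ (v +ᵥ p) = χ p := by
        rw [AffineMap.map_vadd]
        simpa using h0
      have h2 := hχ.1.injOn (AffineSubspace.vadd_mem_of_mem_direction hv hp) hp h1
      simpa using h2
    · intro y
      obtain ⟨x, hx, hxy⟩ := hχ.1.surjOn (Set.mem_univ (y + χ p))
      refine ⟨⟨x - p, AffineSubspace.vsub_mem_direction hx hp⟩, ?_⟩
      have := χ.linearMap_vsub x p
      simp only [vsub_eq_sub] at this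
      simp only at hxy
      simp [this, hxy]
  set e1 := LinearEquiv.ofBijective _ (key φ hφ) with he1
  set e2 := LinearEquiv.ofBijective _ (key ψ hψ) with he2
  set M : (Fin r → ℝ) ≃ₗ[ℝ] (Fin r → ℝ) := e1.symm.trans e2 with hM
  have hMx : ∀ x ∈ affineSpan ℝ S, ψ x = ψ p + M (φ x) := by
    intro x hx
    have hv := AffineSubspace.vsub_mem_direction hx hp
    have h1 : e1 ⟨x - p, hv⟩ = φ x := by
      have := φ.linearMap_vsub x p
      simp only [vsub_eq_sub] at this
      simp [he1, this, hp0]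
    have h2 : e2 ⟨x - p, hv⟩ = ψ x - ψ p := by
      have := ψ.linearMap_vsub x p
      simp only [vsub_eq_sub] at this
      simp [he2, this]
    rw [hM, ← h1]
    simp [h2]
  have hpint : IsIntPt p := (hφ.2 p hp).2 (by rw [hp0]; exact fun i => ⟨0, by simp⟩)
  have hMint : ∀ y, IsIntPt y → IsIntPt (M y) := by
    intro y hy
    obtain ⟨x, hx, hxy⟩ := hφ.1.surjOn (Set.mem_univ y)
    simp only at hxy
    have h1 := hMx x hx
    have h2 : M y = ψ x - ψ p := by rw [h1, hxy]; simp
    rw [h2]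
    exact ((hψ.2 x hx).1 ((hφ.2 x hx).2 (hxy ▸ hy))).sub' ((hψ.2 p hp).1 hpint)
  have himg : (fun x => ψ x) '' S = (fun y => ψ p + y) '' ((M : (Fin r → ℝ) →ₗ[ℝ] _) '' ((fun x => φ x) '' S)) := by
    rw [Set.image_image, Set.image_image]
    exact Set.image_congr fun x hx => hMx x (subset_affineSpan ℝ S hx)
  rw [himg, Set.image_add_left, measure_preimage_add, Measure.addHaar_image_linearMap]
  obtain ⟨m, hm⟩ := int_det (LinearMap.toMatrix' (M : (Fin r → ℝ) →ₗ[ℝ] _)) (fun i j => by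
    rw [LinearMap.toMatrix'_apply]
    exact hMint _ (fun k => by
      by_cases h : k = j
      · exact ⟨1, by simp [h]⟩
      · exact ⟨0, by simp [h]⟩) i)
  rw [LinearMap.det_toMatrix'] at hm
  rw [hm]
  have hm0 : m ≠ 0 := by
    rintro rfl
    have := (LinearEquiv.isUnit_det' M).ne_zero
    rw [hm] at this
    simp at this
  have hm1 : (1 : ℝ) ≤ |(m : ℝ)| := by
    exact_mod_cast Int.one_le_abs hm0
  calc volume ((fun x => φ x) '' S) = 1 * volume ((fun x => φ x) '' S) := (one_mul _).symm
    _ ≤ _ := by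
      gcongr
      exact ENNReal.one_le_ofReal.2 hm1

lemma normVol_eq {n : ℕ} {S : Set (Fin n → ℝ)} {φ : (Fin n → ℝ) →ᵃ[ℝ] (Fin (polyDim S) → ℝ)}
    (hφ : IsLatticeChart S φ) :
    normVol S = (polyDim S).factorial * (volume ((fun x => φ x) '' S)).toReal := by
  have h : ∃ φ : (Fin n → ℝ) →ᵃ[ℝ] (Fin (polyDim S) → ℝ), IsLatticeChart S φ := ⟨φ, hφ⟩
  rw [normVol, dif_pos h, le_antisymm (chart_le h.choose_spec hφ) (chart_le hφ h.choose_spec)]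

lemma package {n : ℕ} {s : Set (Fin n → ℝ)} (hs : ∀ x ∈ s, IsIntPt x) {a : Fin n → ℝ}
    (ha : a ∈ s) (r : ℕ) (hr : polyDim (convexHull ℝ s) = r) :
    ∃ (ι : (Fin r → ℝ) →ₗ[ℝ] (Fin n → ℝ)) (π : (Fin n → ℝ) →ₗ[ℝ] (Fin r → ℝ)),
      (∀ t, π (ι t) = t) ∧ LinearMap.range ι = vectorSpan ℝ s ∧ (∀ t, IsIntPt t → IsIntPt (ι t)) ∧
      (∀ x, IsIntPt x → IsIntPt (π x)) ∧
      (∀ x ∈ affineSpan ℝ s, ι (π (x - a)) = x - a) ∧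
      normVol (convexHull ℝ s) =
        r.factorial * (volume ((fun x => π (x - a)) '' (convexHull ℝ s))).toReal := by
  subst hr
  have hdir : (affineSpan ℝ (convexHull ℝ s)).direction = vectorSpan ℝ s := by
    rw [affineSpan_convexHull, direction_affineSpan]
  obtain ⟨ι, π, h1, h2, h3, h4⟩ := exists_frame (vectorSpan ℝ s) ((fun x => x - a) '' s)
    (by rintro _ ⟨x, hx, rfl⟩; exact (hs x hx).sub' (hs a ha))
    (vectorSpan_eq_span_vsub_set_right ℝ ha) (polyDim (convexHull ℝ s))
    (by rw [polyDim, hdir])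
  have ha' : a ∈ affineSpan ℝ s := subset_affineSpan ℝ s ha
  have h5 : ∀ x ∈ affineSpan ℝ s, ι (π (x - a)) = x - a := by
    intro x hx
    have : x - a ∈ LinearMap.range ι := by
      rw [h2, ← direction_affineSpan]
      exact AffineSubspace.vsub_mem_direction hx ha'
    obtain ⟨t, ht⟩ := this
    rw [← ht, h1]
  refine ⟨ι, π, h1, h2, h3, h4, h5, ?_⟩
  set φ : (Fin n → ℝ) →ᵃ[ℝ] (Fin (polyDim (convexHull ℝ s)) → ℝ) :=
    π.toAffineMap.comp (AffineMap.id ℝ (Fin n → ℝ) - AffineMap.const ℝ _ a) with hφ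
  have hφx : ∀ x, φ x = π (x - a) := fun x => by simp [hφ]
  have hchart : IsLatticeChart (convexHull ℝ s) φ := by
    rw [IsLatticeChart, affineSpan_convexHull]
    refine ⟨⟨fun _ _ => Set.mem_univ _, ?_, ?_⟩, ?_⟩
    · intro x hx y hy hxy
      simp only [hφx] at hxy
      have e1 := h5 x hx
      have e2 := h5 y hy
      rw [hxy, e2] at e1
      simpa using e1.symm
    · intro t _
      refine ⟨ι t + a, ?_, by simp [hφx, h1]⟩
      have : ι t ∈ (affineSpan ℝ s).direction := by
        rw [direction_affineSpan, ← h2]; exact ⟨t, rfl⟩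
      exact AffineSubspace.vadd_mem_of_mem_direction this ha'
    · intro x hx
      rw [hφx]
      refine ⟨fun h => h4 _ (h.sub' (hs a ha)), fun h => ?_⟩
      have := (h3 _ h).add' (hs a ha)
      rw [h5 x hx] at this
      simpa using this
  rw [normVol_eq hchart]
  simp only [hφx]

lemma image_hull {n r : ℕ} (π : (Fin n → ℝ) →ₗ[ℝ] (Fin r → ℝ)) (a : Fin n → ℝ) (s : Set (Fin n → ℝ)) :
    (fun x => π (x - a)) '' (convexHull ℝ s) = convexHull ℝ ((fun x => π (x - a)) '' s) := by
  set φ : (Fin n → ℝ) →ᵃ[ℝ] (Fin r → ℝ) :=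
    π.toAffineMap.comp (AffineMap.id ℝ (Fin n → ℝ) - AffineMap.const ℝ _ a) with hφ
  have hφx : (fun x => π (x - a)) = φ := by ext x; simp [hφ]
  rw [hφx, AffineMap.image_convexHull]

lemma image_span_top {n r : ℕ} {s : Set (Fin n → ℝ)} {a : Fin n → ℝ} (ha : a ∈ s)
    (ι : (Fin r → ℝ) →ₗ[ℝ] (Fin n → ℝ)) (π : (Fin n → ℝ) →ₗ[ℝ] (Fin r → ℝ))
    (h1 : ∀ t, π (ι t) = t) (h2 : LinearMap.range ι = vectorSpan ℝ s) :
    affineSpan ℝ ((fun x => π (x - a)) '' s) = ⊤ := by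
  set φ : (Fin n → ℝ) →ᵃ[ℝ] (Fin r → ℝ) :=
    π.toAffineMap.comp (AffineMap.id ℝ (Fin n → ℝ) - AffineMap.const ℝ _ a) with hφ
  have hφx : ∀ x, φ x = π (x - a) := by intro x; simp [hφ]
  have : (fun x => π (x - a)) = φ := funext fun x => (hφx x).symm
  rw [this, ← AffineSubspace.map_span, eq_top_iff]
  intro t _
  refine ⟨ι t + a, ?_, by simp [hφx, h1]⟩
  have h3 : ι t ∈ (affineSpan ℝ s).direction := by
    rw [direction_affineSpan, ← h2]; exact ⟨t, rfl⟩
  exact AffineSubspace.vadd_mem_of_mem_direction h3 (subset_affineSpan ℝ s ha)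

lemma normVol_int {n : ℕ} {s : Set (Fin n → ℝ)} (hs : ∀ x ∈ s, IsIntPt x) (hne : s.Nonempty)
    (hfin : s.Finite) : ∃ m : ℤ, normVol (convexHull ℝ s) = m := by
  obtain ⟨a, ha⟩ := hne
  obtain ⟨ι, π, h1, h2, h3, h4, h5, h6⟩ := package hs ha _ rfl
  have := hfin.fintype
  obtain ⟨m, hm⟩ := vol_int (fun x : s => π (x.1 - a))
    (fun x => h4 _ ((hs _ x.2).sub' (hs a ha)))
    (by
      have := image_span_top ha ι π h1 h2
      rw [Set.image_eq_range] at this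
      exact this)
  refine ⟨m, ?_⟩
  rw [h6, image_hull, Set.image_eq_range]
  exact hm

lemma even_choose_of_lt {k i j : ℕ} (hi : i < 2 ^ k) (hj : j < 2 ^ k) (hij : 2 ^ k ≤ i + j) :
    2 ∣ (i + j).choose i := by
  have : Fact (Nat.Prime 2) := ⟨Nat.prime_two⟩
  rw [dvd_iff_padicValNat_ne_zero (Nat.choose_pos (by omega)).ne', add_comm i j,
    padicValNat_choose' (Nat.lt_succ_self _)]
  have hk : 1 ≤ k := by
    rcases k with _ | k
    · simp at hi hj; omega
    · omega
  have hlog : k ≤ Nat.log 2 (j + i) := Nat.le_log_of_pow_le (by norm_num) (by omega)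
  apply Finset.card_ne_zero_of_mem (a := k)
  simp only [Finset.mem_filter, Finset.mem_Ico]
  refine ⟨by omega, ?_⟩
  rw [Nat.mod_eq_of_lt hi, Nat.mod_eq_of_lt hj]
  exact hij

def minSet {E : Type*} [AddCommGroup E] [Module ℝ E] (f : E →ₗ[ℝ] ℝ) (A : Set E) : Set E :=
  {x | x ∈ A ∧ ∀ y ∈ A, f x ≤ f y}

def dotLin {n : ℕ} (c : Fin n → ℝ) : (Fin n → ℝ) →ₗ[ℝ] ℝ where
  toFun x := dotR c x
  map_add' x y := by simp [dotR, mul_add, Finset.sum_add_distrib]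
  map_smul' r x := by simp [dotR, Finset.mul_sum, mul_left_comm]

lemma argminSet_eq {n : ℕ} (c : Fin n → ℝ) (P : Set (Fin n → ℝ)) :
    argminSet c P = minSet (dotLin c) P := rfl

lemma exists_dotLin {n : ℕ} (f : (Fin n → ℝ) →ₗ[ℝ] ℝ) : ∃ c, dotLin c = f := by
  classical
  refine ⟨fun i => f (Pi.single i 1), ?_⟩
  apply LinearMap.pi_ext'
  intro i
  ext
  simp [dotLin, dotR, Pi.single_apply]

section
variable {E : Type*} [AddCommGroup E] [Module ℝ E]

lemma minSet_add (f : E →ₗ[ℝ] ℝ) (P Q : Set E) :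
    minSet f (P + Q) = minSet f P + minSet f Q := by
  ext x
  constructor
  · rintro ⟨hx, hm⟩
    obtain ⟨p, hp, q, hq, rfl⟩ := Set.mem_add.1 hx
    refine Set.add_mem_add ⟨hp, fun y hy => ?_⟩ ⟨hq, fun y hy => ?_⟩
    · have := hm _ (Set.add_mem_add hy hq); simp at this; linarith
    · have := hm _ (Set.add_mem_add hp hy); simp at this; linarith
  · intro hx
    obtain ⟨p, hp, q, hq, rfl⟩ := Set.mem_add.1 hx
    refine ⟨Set.add_mem_add hp.1 hq.1, fun y hy => ?_⟩
    obtain ⟨p', hp', q', hq', rfl⟩ := Set.mem_add.1 hy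
    have h1 := hp.2 _ hp'
    have h2 := hq.2 _ hq'
    simp; linarith

lemma minSet_nonempty (f : E →ₗ[ℝ] ℝ) {A : Set E} (hA : A.Finite) (hne : A.Nonempty) :
    (minSet f A).Nonempty := by
  obtain ⟨x, hx, h⟩ := Set.exists_min_image A f hA hne
  exact ⟨x, hx, h⟩

lemma minSet_hull (f : E →ₗ[ℝ] ℝ) {A : Set E} (hA : A.Finite) :
    minSet f (convexHull ℝ A) = convexHull ℝ (minSet f A) := by
  classical
  rcases A.eq_empty_or_nonempty with rfl | hne
  · have : minSet f (∅ : Set E) = ∅ := by ext x; simp [minSet]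
    simp [this]
  obtain ⟨a, ha, hmin⟩ := Set.exists_min_image A f hA hne
  have hlow : convexHull ℝ A ⊆ {x | f a ≤ f x} :=
    convexHull_min (fun x hx => hmin x hx) (convex_halfSpace_ge f.isLinear (f a))
  apply Set.Subset.antisymm
  · rintro x ⟨hx, hm⟩
    have hxa : f x ≤ f a := hm a (subset_convexHull ℝ A ha)
    haveI := hA.fintype
    have hr : ((fun v : A => (v : E)) '' ((Finset.univ : Finset A) : Set A)) = A := by simp
    have hx' := hx
    rw [← hr, mem_hull_weights] at hx'
    obtain ⟨l, h0, -, h1, hs⟩ := hx'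
    have hw := weights_support l (fun v : A => f v) (f a) h0 h1 (fun v => hmin v v.2)
      (by rw [← hs] at hxa; simpa using hxa)
    have : x ∈ convexHull ℝ ((fun v : A => (v : E)) ''
        ((Finset.univ.filter (fun v : A => l v ≠ 0) : Finset A) : Set A)) := by
      rw [mem_hull_weights]
      exact ⟨l, h0, fun j hj => by simpa using hj, h1, hs⟩
    refine convexHull_mono ?_ this
    rintro _ ⟨v, hv, rfl⟩
    have hv' : l v ≠ 0 := by simpa using hv
    exact ⟨v.2, fun y hy => by
      have := hw v hv'
      show f v ≤ f y
      rw [this]; exact hmin y hy⟩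
  · intro x hx
    have h1 : x ∈ convexHull ℝ A := convexHull_mono (fun y hy => hy.1) hx
    have h2 : convexHull ℝ (minSet f A) ⊆ {x | f x ≤ f a} :=
      convexHull_min (fun y hy => hy.2 a ha) (convex_halfSpace_le f.isLinear (f a))
    exact ⟨h1, fun y hy => le_trans (h2 hx) (hlow hy)⟩

lemma face_of_face (c c1 : E →ₗ[ℝ] ℝ) {A : Set E} (hA : A.Finite) :
    ∃ c2 : E →ₗ[ℝ] ℝ, minSet c2 A = minSet c1 (minSet c A) := by
  have hev : ∀ᶠ ε : ℝ in nhdsWithin 0 (Set.Ioi 0), ∀ x ∈ A, ∀ y ∈ A, c x < c y →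
      c x + ε * c1 x < c y + ε * c1 y := by
    rw [Filter.eventually_all_finite hA]
    intro x hx
    rw [Filter.eventually_all_finite hA]
    intro y hy
    by_cases h : c x < c y
    · have h1 : Filter.Tendsto (fun ε : ℝ => c x + ε * c1 x) (nhds 0) (nhds (c x + 0 * c1 x)) :=
        Continuous.tendsto (by fun_prop) 0
      have h2 : Filter.Tendsto (fun ε : ℝ => c y + ε * c1 y) (nhds 0) (nhds (c y + 0 * c1 y)) :=
        Continuous.tendsto (by fun_prop) 0
      have := (h1.eventually_lt h2 (by simpa using h)).filter_mono
        (nhdsWithin_le_nhds (s := Set.Ioi (0:ℝ)))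
      filter_upwards [this] with ε he _ using he
    · exact Filter.Eventually.of_forall fun _ h' => absurd h' h
  obtain ⟨ε, he, hpos⟩ := (hev.and self_mem_nhdsWithin).exists
  replace hpos : 0 < ε := hpos
  refine ⟨c + ε • c1, ?_⟩
  ext x
  constructor
  · rintro ⟨hx, hm⟩
    have hxA : ∀ y ∈ A, c x ≤ c y := by
      intro y hy
      by_contra h
      have h1 := he y hy x hx (not_le.1 h)
      have h2 := hm y hy
      simp at h2
      linarith
    refine ⟨⟨hx, hxA⟩, ?_⟩
    rintro y ⟨hy, hyA⟩
    have h2 := hm y hy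
    have h3 := hyA x hx
    simp at h2
    have : ε * c1 x ≤ ε * c1 y := by linarith
    exact le_of_mul_le_mul_left this hpos
  · rintro ⟨⟨hx, hxA⟩, hm⟩
    refine ⟨hx, fun y hy => ?_⟩
    rcases (hxA y hy).lt_or_eq with h | h
    · have := he x hx y hy h
      simp; linarith
    · have h1 := hm y ⟨hy, fun w hw => h ▸ hxA w hw⟩
      have := mul_le_mul_of_nonneg_left h1 hpos.le
      simp; linarith

end

lemma volume_prod_fin {i j : ℕ} (Y1 : Set (Fin i → ℝ)) (Y2 : Set (Fin j → ℝ))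
    (h1 : MeasurableSet Y1) (h2 : MeasurableSet Y2) :
    volume {y : Fin (i + j) → ℝ | (fun t => y (Fin.castAdd j t)) ∈ Y1 ∧ (fun t => y (Fin.natAdd i t)) ∈ Y2}
      = volume Y1 * volume Y2 := by
  set W := {y : Fin (i + j) → ℝ | (fun t => y (Fin.castAdd j t)) ∈ Y1 ∧ (fun t => y (Fin.natAdd i t)) ∈ Y2}
  have hW : MeasurableSet W := by
    apply MeasurableSet.inter
    · exact h1.preimage (by fun_prop)
    · exact h2.preimage (by fun_prop)
  have e1 := volume_measurePreserving_piCongrLeft (fun _ : Fin (i + j) => ℝ) (finSumFinEquiv (m := i) (n := j))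
  have e2 := volume_measurePreserving_sumPiEquivProdPi (fun _ : Fin i ⊕ Fin j => ℝ)
  rw [← e1.measure_preimage hW.nullMeasurableSet]
  have h12 : MeasurableSet (Y1 ×ˢ Y2) := h1.prod h2
  have := e2.measure_preimage h12.nullMeasurableSet
  rw [Measure.volume_eq_prod, Measure.prod_prod] at this
  rw [← this]
  congr 1
  ext y
  have k1 : ∀ t, (MeasurableEquiv.piCongrLeft (fun _ => ℝ) finSumFinEquiv) y (Fin.castAdd j t) = y (Sum.inl t) := by
    intro t
    have := MeasurableEquiv.piCongrLeft_apply_apply (β := fun _ : Fin (i+j) => ℝ) (finSumFinEquiv (m := i) (n := j)) y (Sum.inl t)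
    simpa using this
  have k2 : ∀ t, (MeasurableEquiv.piCongrLeft (fun _ => ℝ) finSumFinEquiv) y (Fin.natAdd i t) = y (Sum.inr t) := by
    intro t
    have := MeasurableEquiv.piCongrLeft_apply_apply (β := fun _ : Fin (i+j) => ℝ) (finSumFinEquiv (m := i) (n := j)) y (Sum.inr t)
    simpa using this
  simp only [W, Set.mem_preimage, Set.mem_ofPred_eq, k1, k2]
  rfl

lemma det_int {d : ℕ} (T : (Fin d → ℝ) →ₗ[ℝ] (Fin d → ℝ)) (hT : ∀ x, IsIntPt x → IsIntPt (T x)) :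
    ∃ m : ℤ, LinearMap.det T = m := by
  rw [← LinearMap.det_toMatrix']
  apply int_det
  intro a b
  rw [LinearMap.toMatrix'_apply]
  apply hT
  intro t
  by_cases h : t = b
  · exact ⟨1, by simp [h]⟩
  · exact ⟨0, by simp [h]⟩

lemma cell_vol {i j d : ℕ} (hd : i + j = d) (β1 : (Fin i → ℝ) →ₗ[ℝ] (Fin d → ℝ))
    (β2 : (Fin j → ℝ) →ₗ[ℝ] (Fin d → ℝ)) (hβ1 : ∀ x, IsIntPt x → IsIntPt (β1 x))
    (hβ2 : ∀ x, IsIntPt x → IsIntPt (β2 x)) (Y1 : Set (Fin i → ℝ)) (Y2 : Set (Fin j → ℝ))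
    (h1 : MeasurableSet Y1) (h2 : MeasurableSet Y2) (p q : Fin d → ℝ) (C1 C2 : Set (Fin d → ℝ))
    (hC1 : C1 = (fun y => p + β1 y) '' Y1) (hC2 : C2 = (fun y => q + β2 y) '' Y2) :
    ∃ m : ℤ, (volume (C1 + C2)).toReal = m * ((volume Y1).toReal * (volume Y2).toReal) := by
  subst hd
  set T : (Fin (i + j) → ℝ) →ₗ[ℝ] (Fin (i + j) → ℝ) :=
    β1 ∘ₗ LinearMap.funLeft ℝ ℝ (Fin.castAdd j) + β2 ∘ₗ LinearMap.funLeft ℝ ℝ (Fin.natAdd i) with hT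
  obtain ⟨m, hm⟩ := det_int T (by
    intro x hx
    exact (hβ1 _ (fun t => hx _)).add' (hβ2 _ (fun t => hx _)))
  set W := {y : Fin (i + j) → ℝ | (fun t => y (Fin.castAdd j t)) ∈ Y1 ∧ (fun t => y (Fin.natAdd i t)) ∈ Y2} with hW
  have hset : C1 + C2 = (fun y => (p + q) + y) '' (T '' W) := by
    ext x
    rw [Set.image_image]
    constructor
    · intro hx
      obtain ⟨u, hu, v, hv, rfl⟩ := Set.mem_add.1 hx
      rw [hC1] at hu; rw [hC2] at hv
      obtain ⟨y1, hy1, rfl⟩ := hu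
      obtain ⟨y2, hy2, rfl⟩ := hv
      have e1 : (fun t => Fin.append y1 y2 (Fin.castAdd j t)) = y1 := by ext t; simp
      have e2 : (fun t => Fin.append y1 y2 (Fin.natAdd i t)) = y2 := by ext t; simp
      refine ⟨Fin.append y1 y2, ⟨by rw [e1]; exact hy1, by rw [e2]; exact hy2⟩, ?_⟩
      have : T (Fin.append y1 y2) = β1 y1 + β2 y2 := by
        show β1 (fun t => Fin.append y1 y2 (Fin.castAdd j t)) +
          β2 (fun t => Fin.append y1 y2 (Fin.natAdd i t)) = _
        rw [e1, e2]
      simp only [this]; abel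
    · rintro ⟨y, ⟨hy1, hy2⟩, rfl⟩
      rw [hC1, hC2]
      refine Set.mem_add.2 ⟨_, ⟨_, hy1, rfl⟩, _, ⟨_, hy2, rfl⟩, ?_⟩
      show _ = p + q + (β1 (fun t => y (Fin.castAdd j t)) + β2 (fun t => y (Fin.natAdd i t)))
      exact add_add_add_comm _ _ _ _
  refine ⟨|m|, ?_⟩
  rw [hset, Set.image_add_left, measure_preimage_add, Measure.addHaar_image_linearMap, hW,
    volume_prod_fin Y1 Y2 h1 h2, hm]
  simp [ENNReal.toReal_mul]

section
variable {E : Type*} [AddCommGroup E] [Module ℝ E] {I J : Type*} [Fintype I] [Fintype J]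

lemma vectorSpan_cell (z : I → E) (f : E →ₗ[ℝ] ℝ) :
    vectorSpan ℝ (z '' (cellSet z (fun _ => 0) f : Set I)) ≤ LinearMap.ker f := by
  rw [vectorSpan_def, Submodule.span_le]
  rintro _ ⟨_, ⟨a, ha, rfl⟩, _, ⟨b, hb, rfl⟩, rfl⟩
  rw [Finset.mem_coe, mem_cellSet] at ha hb
  have h1 := ha b
  have h2 := hb a
  simp only [vsub_eq_sub, SetLike.mem_coe, LinearMap.mem_ker, map_sub]
  linarith

lemma image_prod_add (zA : I → E) (zB : J → E) (S : Finset I) (T : Finset J) :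
    (fun p : I × J => zA p.1 + zB p.2) '' ((S ×ˢ T : Finset (I × J)) : Set (I × J)) =
      zA '' (S : Set I) + zB '' (T : Set J) := by
  ext x
  simp only [Set.mem_add, Set.mem_image, Finset.coe_product, Set.mem_prod, Prod.exists]
  constructor
  · rintro ⟨a, b, ⟨ha, hb⟩, rfl⟩
    exact ⟨_, ⟨a, ha, rfl⟩, _, ⟨b, hb, rfl⟩, rfl⟩
  · rintro ⟨_, ⟨a, ha, rfl⟩, _, ⟨b, hb, rfl⟩, rfl⟩
    exact ⟨a, b, ⟨ha, hb⟩, rfl⟩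

lemma vectorSpan_add_le (A B : Set E) :
    vectorSpan ℝ (A + B) ≤ vectorSpan ℝ A ⊔ vectorSpan ℝ B := by
  rw [vectorSpan_def, Submodule.span_le]
  rintro _ ⟨x, hx, y, hy, rfl⟩
  obtain ⟨a, ha, b, hb, rfl⟩ := Set.mem_add.1 hx
  obtain ⟨a', ha', b', hb', rfl⟩ := Set.mem_add.1 hy
  have : (a + b) -ᵥ (a' + b') = (a -ᵥ a') + (b -ᵥ b') := by
    simp only [vsub_eq_sub]; abel
  show _ ∈ vectorSpan ℝ A ⊔ vectorSpan ℝ B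
  simp only [this]
  exact Submodule.add_mem_sup (vsub_mem_vectorSpan ℝ ha ha') (vsub_mem_vectorSpan ℝ hb hb')

end

theorem mixed_decomp {E : Type*} [NormedAddCommGroup E] [NormedSpace ℝ E] [FiniteDimensional ℝ E]
    [MeasurableSpace E] [BorelSpace E] (μ : Measure E) [μ.IsAddHaarMeasure]
    {I J : Type*} [Fintype I] [Fintype J] (zA : I → E) (zB : J → E)
    (hfull : affineSpan ℝ (Set.range (fun p : I × J => zA p.1 + zB p.2)) = ⊤) :
    ∃ cs : Finset (Finset (I × J)),
      μ (convexHull ℝ (Set.range (fun p : I × J => zA p.1 + zB p.2))) =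
        ∑ U ∈ cs, μ (convexHull ℝ ((fun p : I × J => zA p.1 + zB p.2) '' (U : Set (I × J)))) ∧
      ∀ U ∈ cs, ∃ (S : Finset I) (T : Finset J) (f g : E →ₗ[ℝ] ℝ), S.Nonempty ∧ T.Nonempty ∧
        S = cellSet zA (fun _ => 0) f ∧ T = cellSet zB (fun _ => 0) g ∧
        (fun p : I × J => zA p.1 + zB p.2) '' (U : Set (I × J)) = zA '' (S : Set I) + zB '' (T : Set J) ∧
        vectorSpan ℝ (zA '' (S : Set I)) ⊓ vectorSpan ℝ (zB '' (T : Set J)) = ⊥ ∧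
        vectorSpan ℝ (zA '' (S : Set I)) ⊔ vectorSpan ℝ (zB '' (T : Set J)) = ⊤ := by
  classical
  set D : Finset I × Finset J → Submodule ℝ E := fun p =>
    vectorSpan ℝ (zA '' (p.1 : Set I)) ⊓ vectorSpan ℝ (zB '' (p.2 : Set J)) with hD
  have hch : ∀ p : {p : Finset I × Finset J // D p ≠ ⊥}, ∃ u ∈ D p.1, u ≠ 0 := fun p =>
    Submodule.exists_mem_ne_zero_of_ne_bot p.2
  choose u hu hu0 using hch
  obtain ⟨ℓ, hℓ⟩ := Module.exists_dual_forall_apply_ne_zero (K := ℝ) u hu0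
  set z : I × J → E := fun p => zA p.1 + zB p.2 with hz
  refine ⟨cells z (fun p => ℓ (zA p.1)), vol_decomp μ z _ hfull, ?_⟩
  intro U hU
  rw [mem_cells] at hU
  obtain ⟨hspan, c, hc⟩ := hU
  have hprod : U = cellSet zA (fun _ => 0) (c + ℓ) ×ˢ cellSet zB (fun _ => 0) c := by
    ext ⟨v, w⟩
    rw [hc, Finset.mem_product, mem_cellSet, mem_cellSet, mem_cellSet]
    constructor
    · intro h
      constructor
      · intro v'
        have := h (v', w)
        simp [hz] at this ⊢
        linarith
      · intro w'
        have := h (v, w')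
        simp [hz] at this ⊢
        linarith
    · rintro ⟨h1, h2⟩ ⟨v', w'⟩
      have k1 := h1 v'
      have k2 := h2 w'
      simp [hz] at k1 k2 ⊢
      linarith
  have hne : U.Nonempty := by
    rw [Finset.nonempty_iff_ne_empty]
    rintro rfl
    simp at hspan
  have himg : z '' (U : Set (I × J)) = zA '' (cellSet zA (fun _ => 0) (c + ℓ) : Set I) +
      zB '' (cellSet zB (fun _ => 0) c : Set J) := by
    rw [hprod]; exact image_prod_add zA zB _ _
  have hne' := hne
  rw [hprod, Finset.nonempty_product] at hne'
  refine ⟨cellSet zA (fun _ => 0) (c + ℓ), cellSet zB (fun _ => 0) c, c + ℓ, c, hne'.1, hne'.2,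
    rfl, rfl, himg, ?_, ?_⟩
  · by_contra hb
    set p : {p : Finset I × Finset J // D p ≠ ⊥} :=
      ⟨(cellSet zA (fun _ => 0) (c + ℓ), cellSet zB (fun _ => 0) c), hb⟩ with hp
    have h1 := vectorSpan_cell zA (c + ℓ) (hu p).1
    have h2 := vectorSpan_cell zB c (hu p).2
    rw [LinearMap.mem_ker] at h1 h2
    apply hℓ p
    simpa [h2] using h1
  · rw [eq_top_iff]
    refine le_trans (le_of_eq ?_) (vectorSpan_add_le _ _)
    rw [← himg, ← direction_affineSpan, hspan, AffineSubspace.direction_top]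

lemma polyDim_hull {n : ℕ} (s : Set (Fin n → ℝ)) :
    polyDim (convexHull ℝ s) = Module.finrank ℝ (vectorSpan ℝ s) := by
  rw [polyDim, affineSpan_convexHull, direction_affineSpan]

lemma vectorSpan_image_sub {n d : ℕ} (π : (Fin n → ℝ) →ₗ[ℝ] (Fin d → ℝ)) (a : Fin n → ℝ)
    (s : Set (Fin n → ℝ)) :
    vectorSpan ℝ ((fun x => π (x - a)) '' s) = (vectorSpan ℝ s).map π := by
  rw [vectorSpan_def, vectorSpan_def, Submodule.map_span]
  congr 1
  ext x
  constructor
  · rintro ⟨_, ⟨u, hu, rfl⟩, _, ⟨v, hv, rfl⟩, rfl⟩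
    exact ⟨u - v, ⟨u, hu, v, hv, rfl⟩, by simp⟩
  · rintro ⟨_, ⟨u, hu, v, hv, rfl⟩, rfl⟩
    exact ⟨_, ⟨u, hu, rfl⟩, _, ⟨v, hv, rfl⟩, by simp⟩

lemma vectorSpan_le_add_left {n : ℕ} (A B : Set (Fin n → ℝ)) (hB : B.Nonempty) :
    vectorSpan ℝ A ≤ vectorSpan ℝ (A + B) := by
  obtain ⟨b, hb⟩ := hB
  rw [vectorSpan_def, Submodule.span_le]
  rintro _ ⟨u, hu, v, hv, rfl⟩
  have := vsub_mem_vectorSpan ℝ (Set.add_mem_add hu hb) (Set.add_mem_add hv hb)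
  simpa using this

lemma finrank_map_inj {n d : ℕ} (π : (Fin n → ℝ) →ₗ[ℝ] (Fin d → ℝ)) (V : Submodule ℝ (Fin n → ℝ))
    (h : ∀ x ∈ V, π x = 0 → x = 0) : Module.finrank ℝ (V.map π) = Module.finrank ℝ V := by
  rw [← LinearMap.range_domRestrict]
  apply LinearMap.finrank_range_of_inj
  rw [← LinearMap.ker_eq_bot, LinearMap.ker_eq_bot']
  rintro ⟨x, hx⟩ h0
  exact Subtype.ext (h x hx h0)

lemma hull_piece {n d : ℕ} (π : (Fin n → ℝ) →ₗ[ℝ] (Fin d → ℝ)) (hπ : ∀ x, IsIntPt x → IsIntPt (π x))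
    (a : Fin n → ℝ) {S : Set (Fin n → ℝ)} (hfin : S.Finite) (hne : S.Nonempty)
    (hs : ∀ x ∈ S, IsIntPt x) (i : ℕ) (hi : polyDim (convexHull ℝ S) = i) :
    ∃ (β : (Fin i → ℝ) →ₗ[ℝ] (Fin d → ℝ)) (Y : Set (Fin i → ℝ)) (p : Fin d → ℝ),
      (∀ x, IsIntPt x → IsIntPt (β x)) ∧ MeasurableSet Y ∧
      (fun x => π (x - a)) '' convexHull ℝ S = (fun y => p + β y) '' Y ∧
      normVol (convexHull ℝ S) = i.factorial * (volume Y).toReal := by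
  obtain ⟨s, hsS⟩ := hne
  obtain ⟨ι1, π1, h1, h2, h3, h4, h5, h6⟩ := package hs hsS i hi
  refine ⟨π ∘ₗ ι1, (fun x => π1 (x - s)) '' convexHull ℝ S, π (s - a), fun x hx => hπ _ (h3 _ hx),
    ?_, ?_, h6⟩
  · refine (IsCompact.image (Set.Finite.isCompact_convexHull ℝ hfin) ?_).measurableSet
    have := LinearMap.continuous_of_finiteDimensional π1
    fun_prop
  · rw [Set.image_image]
    apply Set.image_congr
    intro x hx
    have hx' : x ∈ affineSpan ℝ S := convexHull_subset_affineSpan S hx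
    simp only [LinearMap.comp_apply, h5 x hx']
    rw [← map_add]
    congr 1
    abel

lemma cell_formula {n d : ℕ} (π : (Fin n → ℝ) →ₗ[ℝ] (Fin d → ℝ)) (hπ : ∀ x, IsIntPt x → IsIntPt (π x))
    (a b : Fin n → ℝ) {S T : Set (Fin n → ℝ)} (hSf : S.Finite) (hSn : S.Nonempty)
    (hS : ∀ x ∈ S, IsIntPt x) (hTf : T.Finite) (hTn : T.Nonempty) (hT : ∀ x ∈ T, IsIntPt x)
    (hiS : ∀ x ∈ vectorSpan ℝ S, π x = 0 → x = 0) (hiT : ∀ x ∈ vectorSpan ℝ T, π x = 0 → x = 0)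
    (hinf : vectorSpan ℝ ((fun x => π (x - a)) '' S) ⊓ vectorSpan ℝ ((fun x => π (x - b)) '' T) = ⊥)
    (hsup : vectorSpan ℝ ((fun x => π (x - a)) '' S) ⊔ vectorSpan ℝ ((fun x => π (x - b)) '' T) = ⊤) :
    polyDim (convexHull ℝ S) + polyDim (convexHull ℝ T) = d ∧
    ∃ m : ℤ, d.factorial * (volume (convexHull ℝ
        ((fun x => π (x - a)) '' S + (fun x => π (x - b)) '' T))).toReal =
      d.choose (polyDim (convexHull ℝ S)) * m * normVol (convexHull ℝ S) * normVol (convexHull ℝ T) := by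
  have hd : polyDim (convexHull ℝ S) + polyDim (convexHull ℝ T) = d := by
    rw [polyDim_hull, polyDim_hull, ← finrank_map_inj π _ hiS, ← finrank_map_inj π _ hiT,
      ← vectorSpan_image_sub π a, ← vectorSpan_image_sub π b, ← Submodule.finrank_sup_add_finrank_inf_eq,
      hinf, hsup]
    simp
  refine ⟨hd, ?_⟩
  obtain ⟨β1, Y1, p, k1, k2, k3, k4⟩ := hull_piece π hπ a hSf hSn hS _ rfl
  obtain ⟨β2, Y2, q, l1, l2, l3, l4⟩ := hull_piece π hπ b hTf hTn hT _ rfl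
  obtain ⟨m, hm⟩ := cell_vol hd β1 β2 k1 l1 Y1 Y2 k2 l2 p q _ _ k3 l3
  refine ⟨m, ?_⟩
  rw [convexHull_add, ← image_hull, ← image_hull, hm, k4, l4]
  have hf : (d.factorial : ℝ) = d.choose (polyDim (convexHull ℝ S)) *
      (polyDim (convexHull ℝ S)).factorial * (polyDim (convexHull ℝ T)).factorial := by
    rw [← Nat.choose_mul_factorial_mul_factorial (n := d) (k := polyDim (convexHull ℝ S)) (by omega)]
    have : d - polyDim (convexHull ℝ S) = polyDim (convexHull ℝ T) := by omega
    rw [this]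
    push_cast
    ring
  rw [hf]
  ring

lemma lattice_data {n : ℕ} {P : Set (Fin n → ℝ)} (hP : IsLatticePolytope P) :
    ∃ V : Set (Fin n → ℝ), V.Finite ∧ V.Nonempty ∧ (∀ x ∈ V, IsIntPt x) ∧ P = convexHull ℝ V := by
  obtain ⟨V, hV, rfl⟩ := hP
  refine ⟨_, V.finite_toSet.image _, Set.Nonempty.image _ hV, ?_, rfl⟩
  rintro _ ⟨v, -, rfl⟩ i
  exact ⟨v i, rfl⟩

lemma face_minSet {n : ℕ} {V : Set (Fin n → ℝ)} (hV : V.Finite) (c c1 : (Fin n → ℝ) →ₗ[ℝ] ℝ) :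
    IsFace (convexHull ℝ V) (convexHull ℝ (minSet c1 (minSet c V))) := by
  obtain ⟨c2, h2⟩ := face_of_face c c1 hV
  obtain ⟨e, he⟩ := exists_dotLin c2
  refine Or.inr ⟨e, ?_⟩
  rw [argminSet_eq, he, minSet_hull _ hV, h2]

lemma val_cellSet {n d : ℕ} {A : Set (Fin n → ℝ)} [Fintype A] (π : (Fin n → ℝ) →ₗ[ℝ] (Fin d → ℝ))
    (a : Fin n → ℝ) (f : (Fin d → ℝ) →ₗ[ℝ] ℝ) :
    (fun v : A => π ((v : Fin n → ℝ) - a)) '' (cellSet (fun v : A => π ((v : Fin n → ℝ) - a)) (fun _ => 0) f : Set A) =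
      (fun x => π (x - a)) '' minSet (f ∘ₗ π) A := by
  ext x
  constructor
  · rintro ⟨v, hv, rfl⟩
    rw [Finset.mem_coe, mem_cellSet] at hv
    refine ⟨v, ⟨v.2, fun y hy => ?_⟩, rfl⟩
    have := hv ⟨y, hy⟩
    simp at this ⊢
    linarith
  · rintro ⟨v, ⟨hv, h⟩, rfl⟩
    refine ⟨⟨v, hv⟩, ?_, rfl⟩
    rw [Finset.mem_coe, mem_cellSet]
    intro y
    have := h y y.2
    simp at this ⊢
    linarith

lemma even_combine {k i j : ℕ} (hij : 2 ^ k ≤ i + j) (m : ℤ) {x y : ℝ} (hx : ∃ u : ℤ, x = u)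
    (hy : ∃ u : ℤ, y = u) (hx2 : 2 ^ k ≤ i → ∃ u : ℤ, x = 2 * u) (hy2 : 2 ^ k ≤ j → ∃ u : ℤ, y = 2 * u) :
    ∃ u : ℤ, ((i + j).choose i : ℝ) * m * x * y = 2 * u := by
  obtain ⟨u, rfl⟩ := hx
  obtain ⟨v, rfl⟩ := hy
  by_cases hi : 2 ^ k ≤ i
  · obtain ⟨w, hw⟩ := hx2 hi
    exact ⟨(i + j).choose i * m * w * v, by rw [hw]; push_cast; ring⟩
  by_cases hj : 2 ^ k ≤ j
  · obtain ⟨w, hw⟩ := hy2 hj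
    exact ⟨(i + j).choose i * m * u * w, by rw [hw]; push_cast; ring⟩
  obtain ⟨w, hw⟩ := even_choose_of_lt (not_le.1 hi) (not_le.1 hj) hij
  exact ⟨w * m * u * v, by rw [hw]; push_cast; ring⟩

lemma even_sum {α : Type*} (s : Finset α) (f : α → ℝ) (h : ∀ x ∈ s, ∃ u : ℤ, f x = 2 * u) :
    ∃ u : ℤ, ∑ x ∈ s, f x = 2 * u := by
  choose! u hu using h
  exact ⟨∑ x ∈ s, u x, by push_cast; rw [Finset.mul_sum]; exact Finset.sum_congr rfl hu⟩

theorem main_thm {n : ℕ} (k : ℕ) (P Q : Set (Fin n → ℝ))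
    (hP : InQclass k P) (hQ : InQclass k Q) : InQclass k (P + Q) := by
  classical
  refine ⟨?_, ?_⟩
  · obtain ⟨V, hV, hPV⟩ := hP.1
    obtain ⟨W, hW, hQW⟩ := hQ.1
    refine ⟨V + W, hV.add hW, ?_⟩
    rw [hPV, hQW, ← convexHull_add]
    congr 1
    ext x
    constructor
    · intro hx
      obtain ⟨_, ⟨v, hv, rfl⟩, _, ⟨w, hw, rfl⟩, rfl⟩ := Set.mem_add.1 hx
      refine ⟨v + w, by exact_mod_cast Finset.add_mem_add hv hw, ?_⟩
      ext i; simp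
    · rintro ⟨y, hy, rfl⟩
      obtain ⟨v, hv, w, hw, rfl⟩ := Finset.mem_add.1 (Finset.mem_coe.1 hy)
      refine Set.mem_add.2 ⟨_, ⟨v, hv, rfl⟩, _, ⟨w, hw, rfl⟩, ?_⟩
      ext i; simp
  intro F hF hdim
  rcases hF with rfl | ⟨c, rfl⟩
  · exfalso
    have : polyDim (∅ : Set (Fin n → ℝ)) = 0 := by
      simp [polyDim]
    rw [this] at hdim
    have : 0 < 2 ^ k := by positivity
    omega
  obtain ⟨VP, fP, nP, iP, eP⟩ := lattice_data hP.1
  obtain ⟨VQ, fQ, nQ, iQ, eQ⟩ := lattice_data hQ.1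
  rw [argminSet_eq, minSet_add, eP, eQ, minSet_hull _ fP, minSet_hull _ fQ, ← convexHull_add] at hdim ⊢
  set A := minSet (dotLin c) VP with hA
  set B := minSet (dotLin c) VQ with hB
  have fA : A.Finite := fP.subset fun x hx => hx.1
  have fB : B.Finite := fQ.subset fun x hx => hx.1
  have iA : ∀ x ∈ A, IsIntPt x := fun x hx => iP x hx.1
  have iB : ∀ x ∈ B, IsIntPt x := fun x hx => iQ x hx.1
  have nA : A.Nonempty := minSet_nonempty _ fP nP
  have nB : B.Nonempty := minSet_nonempty _ fQ nQ
  obtain ⟨a, ha⟩ := id nA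
  obtain ⟨b, hb⟩ := id nB
  have iAB : ∀ x ∈ A + B, IsIntPt x := by
    intro x hx
    obtain ⟨u, hu, v, hv, rfl⟩ := Set.mem_add.1 hx
    exact (iA u hu).add' (iB v hv)
  obtain ⟨d, hd⟩ : ∃ d, polyDim (convexHull ℝ (A + B)) = d := ⟨_, rfl⟩
  obtain ⟨ι, π, h1, h2, h3, h4, h5, h6⟩ := package iAB (Set.add_mem_add ha hb) d hd
  have hinj : ∀ x ∈ vectorSpan ℝ (A + B), π x = 0 → x = 0 := by
    intro x hx h0
    rw [← h2] at hx
    obtain ⟨t, rfl⟩ := hx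
    rw [h1] at h0
    simp [h0]
  have htop := image_span_top (Set.add_mem_add ha hb) ι π h1 h2
  have := fA.fintype
  have := fB.fintype
  set zA : A → (Fin d → ℝ) := fun v => π ((v : Fin n → ℝ) - a) with hzA
  set zB : B → (Fin d → ℝ) := fun v => π ((v : Fin n → ℝ) - b) with hzB
  have hrange : Set.range (fun p : A × B => zA p.1 + zB p.2) = (fun x => π (x - (a + b))) '' (A + B) := by
    ext x
    constructor
    · rintro ⟨⟨v, w⟩, rfl⟩
      refine ⟨_, Set.add_mem_add v.2 w.2, ?_⟩
      simp only [hzA, hzB]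
      rw [← map_add]; congr 1; abel
    · rintro ⟨y, hy, rfl⟩
      obtain ⟨v, hv, w, hw, rfl⟩ := Set.mem_add.1 hy
      refine ⟨(⟨v, hv⟩, ⟨w, hw⟩), ?_⟩
      simp only [hzA, hzB]
      rw [← map_add]; congr 1; abel
  rw [← hrange] at htop
  obtain ⟨cs, hvol, hcs⟩ := mixed_decomp volume zA zB htop
  rw [EvenVol, h6, image_hull, ← hrange, hvol, ENNReal.toReal_sum, Finset.mul_sum]
  swap
  · intro U _
    exact (Set.Finite.isCompact_convexHull ℝ ((Set.toFinite _).image _)).measure_lt_top.ne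
  apply even_sum
  intro U hU
  obtain ⟨S, T, f, g, nS, nT, rfl, rfl, hUimg, hinf, hsup⟩ := hcs U hU
  rw [hUimg]
  rw [hzA, hzB, val_cellSet π a f, val_cellSet π b g] at *
  have mA : minSet (f ∘ₗ π) A ⊆ A := fun x hx => hx.1
  have mB : minSet (g ∘ₗ π) B ⊆ B := fun x hx => hx.1
  have hiS : ∀ x ∈ vectorSpan ℝ (minSet (f ∘ₗ π) A), π x = 0 → x = 0 := fun x hx =>
    hinj x (vectorSpan_le_add_left A B nB (vectorSpan_mono ℝ mA hx))
  have hiT : ∀ x ∈ vectorSpan ℝ (minSet (g ∘ₗ π) B), π x = 0 → x = 0 := fun x hx =>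
    hinj x (by rw [add_comm]; exact vectorSpan_le_add_left B A nA (vectorSpan_mono ℝ mB hx))
  obtain ⟨hij, m, hm⟩ := cell_formula π h4 a b (fA.subset mA) (minSet_nonempty _ fA nA)
    (fun x hx => iA x (mA hx)) (fB.subset mB) (minSet_nonempty _ fB nB)
    (fun x hx => iB x (mB hx)) hiS hiT hinf hsup
  rw [hm]
  have hFP := hP.2 (convexHull ℝ (minSet (f ∘ₗ π) A)) (eP ▸ face_minSet fP _ _)
  have hFQ := hQ.2 (convexHull ℝ (minSet (g ∘ₗ π) B)) (eQ ▸ face_minSet fQ _ _)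
  have := even_combine (k := k) (by rw [hij, ← hd]; exact hdim) m
    (normVol_int (fun x hx => iA x (mA hx)) (minSet_nonempty _ fA nA) (fA.subset mA))
    (normVol_int (fun x hx => iB x (mB hx)) (minSet_nonempty _ fB nB) (fB.subset mB)) hFP hFQ
  rwa [hij] at this

/-- The class `Q_k` is closed under Minkowski sums. -/
theorem Qk_closed_under_minkowski_sum {n : ℕ} (k : ℕ) (P Q : Set (Fin n → ℝ))
    (hP : InQclass k P) (hQ : InQclass k Q) : InQclass k (P + Q) :=
  main_thm k P Q hP hQ

end
end
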